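/- arXiv:1506.03759 — 2 statements merged into one kernel-verified Lean document; each statement's English description precedes it below -/
import Mathlib

section
/- For n ≥ 6, the maximum number of edges in an n-vertex P³₃-free 3-graph that contains at least one copy of the triangle C³₃ equals 20 + ex₃(n-6; P³₃), where ex₃(m; P³₃) is the Turán number of P³₃. -/
/-- `H` contains a copy of the 3-uniform linear path `P³₃`. -/
def HasP33 {V : Type*} [DecidableEq V] (H : Finset (Finset V)) : Prop :=
  ∃ e₁ e₂ e₃, e₁ ∈ H ∧ e₂ ∈ H ∧ e₃ ∈ H ∧
    (e₁ ∩ e₂).card = 1 ∧ (e₂ ∩ e₃).card = 1 ∧ e₁ ∩ e₃ = ∅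

/-- `H` contains a copy of the 3-uniform triangle `C³₃`. -/
def HasC33 {V : Type*} [DecidableEq V] (H : Finset (Finset V)) : Prop :=
  ∃ a b c d e f : V, ({a, b, c, d, e, f} : Finset V).card = 6 ∧
    ({a, b, c} : Finset V) ∈ H ∧ ({c, d, e} : Finset V) ∈ H ∧ ({e, f, a} : Finset V) ∈ H

/-- The Turán number `ex₃(m; P³₃)`. -/
noncomputable def ex3P33 (m : ℕ) : ℕ :=
  sSup {k : ℕ | ∃ H : Finset (Finset (Fin m)),
    (∀ e ∈ H, e.card = 3) ∧ ¬ HasP33 H ∧ H.card = k}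

namespace CT

open Finset

section gen
variable {V : Type*} [DecidableEq V]

lemma ex_set_bdd (m : ℕ) : BddAbove {k : ℕ | ∃ H : Finset (Finset (Fin m)),
    (∀ e ∈ H, e.card = 3) ∧ ¬ HasP33 H ∧ H.card = k} := by
  refine ⟨Fintype.card (Finset (Fin m)), ?_⟩
  rintro k ⟨H, -, -, rfl⟩
  exact Finset.card_le_univ H

lemma ex_attained (m : ℕ) : ∃ H : Finset (Finset (Fin m)),
    (∀ e ∈ H, e.card = 3) ∧ ¬ HasP33 H ∧ H.card = ex3P33 m := by
  have := Nat.sSup_mem (s := {k : ℕ | ∃ H : Finset (Finset (Fin m)),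
    (∀ e ∈ H, e.card = 3) ∧ ¬ HasP33 H ∧ H.card = k})
    ⟨0, ∅, by simp, by simp [HasP33], by simp⟩ (ex_set_bdd m)
  exact this

lemma le_ex {m : ℕ} (H : Finset (Finset (Fin m))) (h3 : ∀ e ∈ H, e.card = 3)
    (hP : ¬ HasP33 H) : H.card ≤ ex3P33 m :=
  le_csSup (ex_set_bdd m) ⟨H, h3, hP, rfl⟩

/-- Image of a P-free family under an embedding is P-free. -/
lemma map_free {W : Type*} [DecidableEq W] (ψ : W ↪ V) (F : Finset (Finset W))
    (hP : ¬ HasP33 F) : ¬ HasP33 (F.image (fun e => e.map ψ)) := by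
  rintro ⟨e₁, e₂, e₃, h1, h2, h3, h12, h23, h13⟩
  simp only [mem_image] at h1 h2 h3
  obtain ⟨f₁, hf1, rfl⟩ := h1
  obtain ⟨f₂, hf2, rfl⟩ := h2
  obtain ⟨f₃, hf3, rfl⟩ := h3
  rw [← Finset.map_inter, card_map] at h12 h23
  rw [← Finset.map_inter, Finset.map_eq_empty] at h13
  exact hP ⟨f₁, f₂, f₃, hf1, hf2, hf3, h12, h23, h13⟩

lemma map_fam_card {W : Type*} [DecidableEq W] (ψ : W ↪ V) (F : Finset (Finset W)) :
    (F.image (fun e => e.map ψ)).card = F.card :=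
  card_image_of_injective _ (Finset.map_injective ψ)

lemma le_ex_of_subset {m : ℕ} (W : Finset V) (hW : W.card = m) (F : Finset (Finset V))
    (h3 : ∀ e ∈ F, e.card = 3) (hs : ∀ e ∈ F, e ⊆ W) (hP : ¬ HasP33 F) :
    F.card ≤ ex3P33 m := by
  classical
  let q : Fin m ≃ W := (W.equivFinOfCardEq hW).symm
  let ψ : Fin m ↪ V := q.toEmbedding.trans (Function.Embedding.subtype _)
  have hmap : ∀ e ∈ F, (univ.filter (fun i => ψ i ∈ e)).map ψ = e := by
    intro e he
    ext v
    simp only [mem_map, mem_filter, mem_univ, true_and]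
    constructor
    · rintro ⟨i, hi, rfl⟩; exact hi
    · intro hv
      refine ⟨q.symm ⟨v, hs e he hv⟩, ?_, ?_⟩ <;> simp [ψ, hv]
  let G : Finset (Finset (Fin m)) := univ.filter (fun A => A.map ψ ∈ F)
  have hG : G.image (fun e => e.map ψ) = F := by
    ext e
    simp only [mem_image, G, mem_filter, mem_univ, true_and]
    constructor
    · rintro ⟨A, hA, rfl⟩; exact hA
    · intro he
      exact ⟨_, by rw [hmap e he]; exact he, hmap e he⟩
  rw [← hG, map_fam_card]
  apply le_ex
  · intro A hA
    have := h3 _ (mem_filter.1 hA).2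
    simpa using this
  · rintro ⟨e₁, e₂, e₃, h1, h2, h3, h12, h23, h13⟩
    refine hP ⟨e₁.map ψ, e₂.map ψ, e₃.map ψ, (mem_filter.1 h1).2, (mem_filter.1 h2).2,
      (mem_filter.1 h3).2, ?_, ?_, ?_⟩
    · rw [← Finset.map_inter, card_map, h12]
    · rw [← Finset.map_inter, card_map, h23]
    · rw [← Finset.map_inter, h13, Finset.map_empty]

lemma union_free {A B : Finset V} (hAB : Disjoint A B) {F G : Finset (Finset V)}
    (hF : ∀ e ∈ F, e ⊆ A) (hG : ∀ e ∈ G, e ⊆ B) (hPF : ¬ HasP33 F) (hPG : ¬ HasP33 G) :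
    ¬ HasP33 (F ∪ G) := by
  have key : ∀ e f, e ∈ F → f ∈ G → (e ∩ f).card = 1 → False := by
    intro e f he hf h
    have : Disjoint e f := Disjoint.mono (hF e he) (hG f hf) hAB
    rw [disjoint_iff_inter_eq_empty.1 this] at h
    simp at h
  rintro ⟨e₁, e₂, e₃, h1, h2, h3, h12, h23, h13⟩
  rw [mem_union] at h1 h2 h3
  have h21 : (e₂ ∩ e₁).card = 1 := by rw [inter_comm]; exact h12
  have h32 : (e₃ ∩ e₂).card = 1 := by rw [inter_comm]; exact h23
  rcases h2 with h2 | h2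
  · have h1 := h1.resolve_right (fun h => key _ _ h2 h h21)
    have h3 := h3.resolve_right (fun h => key _ _ h2 h h23)
    exact hPF ⟨_, _, _, h1, h2, h3, h12, h23, h13⟩
  · have h1 := h1.resolve_left (fun h => key _ _ h h2 h12)
    have h3 := h3.resolve_left (fun h => key _ _ h h2 h32)
    exact hPG ⟨_, _, _, h1, h2, h3, h12, h23, h13⟩

lemma fam_disj {A B : Finset V} (hAB : Disjoint A B) {F G : Finset (Finset V)}
    (hF : ∀ e ∈ F, e ⊆ A) (hG : ∀ e ∈ G, e ⊆ B) (hF3 : ∀ e ∈ F, e.card = 3) :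
    Disjoint F G := by
  rw [Finset.disjoint_left]
  intro e he hg
  have : Disjoint e e := Disjoint.mono (hF e he) (hG e hg) hAB
  rw [disjoint_self] at this
  have h := hF3 e he
  rw [this] at h
  simp at h

lemma exists_star (X : Finset V) : ∃ F : Finset (Finset V), (∀ e ∈ F, e.card = 3) ∧
    (∀ e ∈ F, e ⊆ X) ∧ ¬ HasP33 F ∧ F.card = (X.card - 1).choose 2 := by
  rcases X.eq_empty_or_nonempty with rfl | ⟨x, hx⟩
  · exact ⟨∅, by simp, by simp, by simp [HasP33], by simp⟩
  · refine ⟨(powersetCard 2 (X.erase x)).image (insert x), ?_, ?_, ?_, ?_⟩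
    · intro e he
      obtain ⟨f, hf, rfl⟩ := mem_image.1 he
      rw [mem_powersetCard] at hf
      rw [card_insert_of_notMem (fun h => by simpa using hf.1 h), hf.2]
    · intro e he
      obtain ⟨f, hf, rfl⟩ := mem_image.1 he
      rw [mem_powersetCard] at hf
      exact insert_subset hx (hf.1.trans (erase_subset _ _))
    · rintro ⟨e₁, e₂, e₃, h1, h2, h3, h12, h23, h13⟩
      obtain ⟨f, hf, rfl⟩ := mem_image.1 h1
      obtain ⟨g, hg, rfl⟩ := mem_image.1 h3
      have : x ∈ insert x f ∩ insert x g := by simp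
      rw [h13] at this
      simp at this
    · rw [card_image_of_injOn, card_powersetCard, card_erase_of_mem hx]
      intro f hf g hg h
      simp only [mem_coe, mem_powersetCard] at hf hg
      have h1 : x ∉ f := fun h => by simpa using hf.1 h
      have h2 : x ∉ g := fun h => by simpa using hg.1 h
      rw [← erase_insert h1, ← erase_insert h2]
      exact congrArg (fun s => s.erase x) h

lemma six_free (U : Finset V) (hU : U.card = 6) : ¬ HasP33 (powersetCard 3 U) := by
  rintro ⟨e₁, e₂, e₃, h1, h2, h3, h12, h23, h13⟩
  rw [mem_powersetCard] at h1 h2 h3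
  have hd : Disjoint e₁ e₃ := disjoint_iff_inter_eq_empty.2 h13
  have hu : e₁ ∪ e₃ = U := by
    apply eq_of_subset_of_card_le (union_subset h1.1 h3.1)
    rw [card_union_of_disjoint hd]; omega
  have : e₂ = (e₁ ∩ e₂) ∪ (e₂ ∩ e₃) := by
    ext v
    have := fun h : v ∈ e₂ => h2.1 h
    rw [← hu] at this
    simp only [mem_union, mem_inter] at *
    tauto
  have h := card_union_le (e₁ ∩ e₂) (e₂ ∩ e₃)
  rw [← this] at h
  omega

end gen

/-! ### The finite part, on `Fin 6` -/

def CC : Finset (Finset (Fin 6)) := {{0,1,2},{2,3,4},{4,5,0}}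
def PP : Finset (Finset (Fin 6)) := {{0,2},{2,4},{4,0},{0,3},{2,5},{4,1}}

def bad (A g : Finset (Fin 6)) : Prop :=
  ∃ B ∈ CC, ((A ∩ B).card = 1 ∧ (B ∩ g).card = 1 ∧ A ∩ g = ∅) ∨
    ((B ∩ A).card = 1 ∧ (A ∩ g).card = 1 ∧ B ∩ g = ∅)

instance (A g : Finset (Fin 6)) : Decidable (bad A g) := by unfold bad; infer_instance

def good (A : Finset (Fin 6)) : Finset (Finset (Fin 6)) :=
  (powersetCard 3 univ).filter (fun g => ¬ bad A g)

set_option maxRecDepth 100000 in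
lemma D1 : ∀ A : Finset (Fin 6), A.card = 1 ∨ (A.card = 2 ∧ A ∉ PP) →
    ∃ B ∈ CC, ∃ B' ∈ CC, (A ∩ B).card = 1 ∧ (B ∩ B').card = 1 ∧ A ∩ B' = ∅ := by
  decide +kernel

lemma D4 : ∀ A ∈ PP, ∀ A' ∈ PP, A ∩ A' = ∅ → ∃ B ∈ CC, (A ∩ B).card = 1 ∧ (B ∩ A').card = 1 := by
  decide +kernel

lemma D5 : ∀ A ∈ PP, ∃ B ∈ CC, (B ∩ A).card = 1 := by decide +kernel

lemma E1 : ∀ A ∈ PP, (good A).card ≤ 15 := by decide +kernel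

lemma E2 : ∀ A ∈ PP, ∀ B ∈ PP, A ≠ B → (good A ∩ good B).card ≤ 12 := by decide +kernel

lemma E3 : ∀ A ∈ PP, ∀ B ∈ PP, ∀ D ∈ PP, A ≠ B → A ≠ D → B ≠ D →
    (good A ∩ good B ∩ good D).card ≤ 10 := by decide +kernel

section upper
variable {V : Type*} [DecidableEq V]

def tr (φ : Fin 6 ↪ V) (e : Finset V) : Finset (Fin 6) := univ.filter (fun i => φ i ∈ e)

lemma inter_tr (φ : Fin 6 ↪ V) (e : Finset V) (B : Finset (Fin 6)) :
    e ∩ B.map φ = (tr φ e ∩ B).map φ := by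
  ext v
  simp only [mem_inter, mem_map, tr, mem_filter, mem_univ, true_and]
  constructor
  · rintro ⟨h, i, hi, rfl⟩; exact ⟨i, ⟨h, hi⟩, rfl⟩
  · rintro ⟨i, ⟨h, hi⟩, rfl⟩; exact ⟨h, i, hi, rfl⟩

lemma card_tr (φ : Fin 6 ↪ V) (e : Finset V) (B : Finset (Fin 6)) :
    (e ∩ B.map φ).card = (tr φ e ∩ B).card := by rw [inter_tr, card_map]

lemma card_tr' (φ : Fin 6 ↪ V) (e : Finset V) (B : Finset (Fin 6)) :
    (B.map φ ∩ e).card = (B ∩ tr φ e).card := by rw [inter_comm, card_tr, inter_comm]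

lemma tr_insert (φ : Fin 6 ↪ V) (x : V) (hx : x ∉ univ.map φ) (A : Finset (Fin 6)) :
    tr φ (insert x (A.map φ)) = A := by
  ext i
  have : φ i ≠ x := by rintro rfl; simp at hx
  simp [tr, this]

/-- outside vertices joined to the pair `A` -/
def XA [Fintype V] (H : Finset (Finset V)) (φ : Fin 6 ↪ V) (A : Finset (Fin 6)) : Finset V :=
  univ.filter (fun x => x ∉ univ.map φ ∧ insert x (A.map φ) ∈ H)

variable [Fintype V] {H : Finset (Finset V)} {φ : Fin 6 ↪ V}

lemma mem_XA {A : Finset (Fin 6)} {x : V} :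
    x ∈ XA H φ A ↔ x ∉ univ.map φ ∧ insert x (A.map φ) ∈ H := by simp [XA]

lemma inner_le (hP : ¬ HasP33 H) (h3 : ∀ e ∈ H, e.card = 3)
    (hC : ∀ B ∈ CC, B.map φ ∈ H) (Q : Finset (Finset (Fin 6)))
    (hQ : ∀ g, g ∈ powersetCard 3 univ →
      (∀ A ∈ PP, (XA H φ A).Nonempty → g ∈ good A) → g ∈ Q) :
    (H.filter (fun e => e ⊆ univ.map φ)).card ≤ Q.card := by
  rw [← map_fam_card φ Q]
  apply card_le_card
  intro e he
  rw [mem_filter] at he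
  have hm : (tr φ e).map φ = e := by
    have := inter_tr φ e univ
    rw [inter_univ, inter_eq_left.2 he.2] at this
    exact this.symm
  refine mem_image.2 ⟨tr φ e, ?_, hm⟩
  have hgH : (tr φ e).map φ ∈ H := by rw [hm]; exact he.1
  have hg3 : tr φ e ∈ powersetCard 3 univ := by
    rw [mem_powersetCard]
    refine ⟨subset_univ _, ?_⟩
    rw [← card_map φ, hm, h3 e he.1]
  generalize tr φ e = g at hgH hg3
  apply hQ g hg3
  rintro A hA ⟨x, hx⟩
  rw [mem_XA] at hx
  refine mem_filter.2 ⟨hg3, ?_⟩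
  rintro ⟨B, hB, h | h⟩
  · refine hP ⟨_, _, _, hx.2, hC B hB, hgH, ?_, ?_, ?_⟩
    · rw [card_tr, tr_insert _ _ hx.1]; exact h.1
    · rw [← map_inter, card_map]; exact h.2.1
    · rw [inter_tr, tr_insert _ _ hx.1, h.2.2, map_empty]
  · refine hP ⟨_, _, _, hC B hB, hx.2, hgH, ?_, ?_, ?_⟩
    · rw [card_tr', tr_insert _ _ hx.1]; exact h.1
    · rw [card_tr, tr_insert _ _ hx.1]; exact h.2.1
    · rw [← map_inter, h.2.2, map_empty]

lemma two_types (hP : ¬ HasP33 H) (hC : ∀ B ∈ CC, B.map φ ∈ H)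
    (A A' : Finset (Fin 6)) (hA : A ∈ PP) (hA' : A' ∈ PP) (hd : A ∩ A' = ∅)
    (x y : V) (hx : x ∈ XA H φ A) (hy : y ∈ XA H φ A') : x = y := by
  by_contra hxy
  rw [mem_XA] at hx hy
  obtain ⟨B, hB, h1, h2⟩ := D4 A hA A' hA' hd
  refine hP ⟨_, _, _, hx.2, hC B hB, hy.2, ?_, ?_, ?_⟩
  · rw [card_tr, tr_insert _ _ hx.1]; exact h1
  · rw [card_tr', tr_insert _ _ hy.1]; exact h2
  · have h : insert x (A.map φ) ∩ A'.map φ = ∅ := by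
      rw [inter_tr, tr_insert _ _ hx.1, hd, map_empty]
    have h' : y ∉ insert x (A.map φ) := by
      rw [mem_insert]
      rintro (h | h)
      · exact hxy h.symm
      · exact hy.1 (map_subset_map.2 (subset_univ A) h)
    rw [inter_insert_of_notMem h', h]

lemma pair_bound (hP : ¬ HasP33 H) (hC : ∀ B ∈ CC, B.map φ ∈ H)
    (A A' : Finset (Fin 6)) (hA : A ∈ PP) (hA' : A' ∈ PP) (hd : A ∩ A' = ∅) :
    (XA H φ A).card + (XA H φ A').card ≤ max 2 (PP.biUnion (XA H φ)).card := by
  have s1 := card_le_card (subset_biUnion_of_mem (XA H φ) hA)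
  have s2 := card_le_card (subset_biUnion_of_mem (XA H φ) hA')
  rcases (XA H φ A).eq_empty_or_nonempty with h | ⟨x, hx⟩
  · rw [h, card_empty]; omega
  rcases (XA H φ A').eq_empty_or_nonempty with h | ⟨y, hy⟩
  · rw [h, card_empty]; omega
  have c1 : (XA H φ A).card ≤ 1 := card_le_one.2 (fun u hu v hv =>
    (two_types hP hC A A' hA hA' hd u y hu hy).trans
      (two_types hP hC A A' hA hA' hd v y hv hy).symm)
  have c2 : (XA H φ A').card ≤ 1 := card_le_one.2 (fun u hu v hv =>
    (two_types hP hC A A' hA hA' hd x u hx hu).symm.trans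
      (two_types hP hC A A' hA hA' hd x v hx hv))
  omega

lemma sum_PP (f : Finset (Fin 6) → ℕ) : ∑ A ∈ PP, f A =
    (f {0,2} + f {4,1}) + (f {2,4} + f {0,3}) + (f {4,0} + f {2,5}) := by
  have : PP = {{0,2},{4,1},{2,4},{0,3},{4,0},{2,5}} := by decide +kernel
  rw [this, sum_insert (by decide), sum_insert (by decide), sum_insert (by decide),
    sum_insert (by decide), sum_insert (by decide), sum_singleton]
  ring

lemma sum_le (hP : ¬ HasP33 H) (hC : ∀ B ∈ CC, B.map φ ∈ H) :
    ∑ A ∈ PP, (XA H φ A).card ≤ 3 * max 2 (PP.biUnion (XA H φ)).card := by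
  rw [sum_PP]
  have h1 := pair_bound hP hC {0,2} {4,1} (by decide) (by decide) (by decide)
  have h2 := pair_bound hP hC {2,4} {0,3} (by decide) (by decide) (by decide)
  have h3 := pair_bound hP hC {4,0} {2,5} (by decide) (by decide) (by decide)
  omega

lemma cover (hP : ¬ HasP33 H) (h3 : ∀ e ∈ H, e.card = 3) (hC : ∀ B ∈ CC, B.map φ ∈ H) :
    H ⊆ (H.filter (fun e => e ⊆ univ.map φ)) ∪
      (PP.biUnion (fun A => (XA H φ A).image (fun x => insert x (A.map φ)))) ∪
      (H.filter (fun e => e ⊆ (univ.map φ)ᶜ \ PP.biUnion (XA H φ))) := by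
  intro e he
  have hi : e ∩ univ.map φ = (tr φ e).map φ := by rw [inter_tr, inter_univ]
  have hci : (e ∩ univ.map φ).card = (tr φ e).card := by rw [hi, card_map]
  have hsd := card_sdiff_add_card_inter e (univ.map φ)
  rw [h3 e he, hci] at hsd
  have hD : ¬ ((tr φ e).card = 1 ∨ ((tr φ e).card = 2 ∧ tr φ e ∉ PP)) := by
    intro h
    obtain ⟨B, hB, B', hB', h1, h2, h3⟩ := D1 _ h
    refine hP ⟨e, _, _, he, hC B hB, hC B' hB', ?_, ?_, ?_⟩
    · rw [card_tr]; exact h1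
    · rw [← map_inter, card_map]; exact h2
    · rw [inter_tr, h3, map_empty]
  push Not at hD
  rw [mem_union, mem_union]
  have hk : (tr φ e).card = 0 ∨ (tr φ e).card = 2 ∨ (tr φ e).card = 3 := by
    have := hD.1
    omega
  rcases hk with hk | hk | hk
  · right
    rw [mem_filter]
    refine ⟨he, ?_⟩
    have h0 : tr φ e = ∅ := card_eq_zero.1 hk
    intro v hv
    rw [mem_sdiff, mem_compl]
    refine ⟨?_, ?_⟩
    · intro hvU
      have : v ∈ e ∩ univ.map φ := mem_inter.2 ⟨hv, hvU⟩
      rw [hi, h0] at this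
      simp at this
    · intro hvX
      obtain ⟨A, hA, hx⟩ := mem_biUnion.1 hvX
      rw [mem_XA] at hx
      obtain ⟨B, hB, h1⟩ := D5 A hA
      refine hP ⟨_, _, _, hC B hB, hx.2, he, ?_, ?_, ?_⟩
      · rw [card_tr', tr_insert _ _ hx.1]; exact h1
      · have : A.map φ ∩ e = ∅ := by rw [inter_comm, inter_tr, h0, empty_inter, map_empty]
        rw [insert_inter_of_mem hv, this]
        simp
      · rw [inter_comm, inter_tr, h0, empty_inter, map_empty]
  · left; right
    have hA := hD.2 hk
    have h1 : (e \ univ.map φ).card = 1 := by omega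
    obtain ⟨x, hx⟩ := card_eq_one.1 h1
    have hxm : x ∈ e \ univ.map φ := by rw [hx]; simp
    rw [mem_sdiff] at hxm
    have hins : insert x ((tr φ e).map φ) = e := by
      rw [← hi, insert_eq, ← hx, sdiff_union_inter]
    refine mem_biUnion.2 ⟨tr φ e, hA, mem_image.2 ⟨x, ?_, hins⟩⟩
    rw [mem_XA, hins]
    exact ⟨hxm.2, he⟩
  · left; left
    rw [mem_filter]
    refine ⟨he, ?_⟩
    have : (e \ univ.map φ).card = 0 := by omega
    exact sdiff_eq_empty_iff_subset.1 (card_eq_zero.1 this)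

lemma free_mono {F G : Finset (Finset V)} (h : F ⊆ G) (hG : ¬ HasP33 G) : ¬ HasP33 F := by
  rintro ⟨e₁, e₂, e₃, h1, h2, h3, h⟩
  exact hG ⟨e₁, e₂, e₃, by tauto, by tauto, by tauto, h⟩

lemma outer_le (hP : ¬ HasP33 H) (h3 : ∀ e ∈ H, e.card = 3) :
    (H.filter (fun e => e ⊆ (univ.map φ)ᶜ \ PP.biUnion (XA H φ))).card +
      ((PP.biUnion (XA H φ)).card - 1).choose 2 ≤ ex3P33 (Fintype.card V - 6) := by
  set X := PP.biUnion (XA H φ) with hX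
  have hXU : X ⊆ (univ.map φ)ᶜ := by
    intro v hv
    obtain ⟨A, hA, hx⟩ := mem_biUnion.1 hv
    rw [mem_XA] at hx
    exact mem_compl.2 hx.1
  obtain ⟨F, hF3, hFX, hFP, hFc⟩ := exists_star X
  set G := H.filter (fun e => e ⊆ (univ.map φ)ᶜ \ X) with hG
  have hGs : ∀ e ∈ G, e ⊆ (univ.map φ)ᶜ \ X := fun e he => (mem_filter.1 he).2
  have hG3 : ∀ e ∈ G, e.card = 3 := fun e he => h3 e (mem_filter.1 he).1
  have hdis : Disjoint ((univ.map φ)ᶜ \ X) X := sdiff_disjoint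
  rw [← hFc, ← card_union_of_disjoint (fam_disj hdis hGs hFX hG3)]
  apply le_ex_of_subset ((univ.map φ)ᶜ)
  · rw [card_compl, card_map]; simp
  · intro e he
    rcases mem_union.1 he with h | h
    · exact hG3 e h
    · exact hF3 e h
  · intro e he
    rcases mem_union.1 he with h | h
    · exact (hGs e h).trans sdiff_subset
    · exact (hFX e h).trans hXU
  · exact union_free hdis hGs hFX (free_mono (filter_subset _ _) hP) hFP

lemma choose_bound (t : ℕ) : 3 * t ≤ (t - 1).choose 2 + 10 := by
  induction t using Nat.strong_induction_on with
  | _ t ih =>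
    by_cases ht : t ≤ 6
    · interval_cases t <;> decide
    · obtain ⟨s, rfl⟩ : ∃ s, t = s + 2 := ⟨t - 2, by omega⟩
      have := ih (s + 1) (by omega)
      have h2 : (s + 2 - 1).choose 2 = s + s.choose 2 := by
        have := Nat.choose_succ_succ s 1
        simpa using this
      rw [h2]
      simp only [Nat.add_sub_cancel] at this
      omega

lemma upper (hP : ¬ HasP33 H) (h3 : ∀ e ∈ H, e.card = 3) (hC : ∀ B ∈ CC, B.map φ ∈ H) :
    H.card ≤ 20 + ex3P33 (Fintype.card V - 6) := by
  have hcov := card_le_card (cover (φ := φ) hP h3 hC)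
  have ho := outer_le (φ := φ) hP h3
  have hs := sum_le hP hC
  have hb := choose_bound (PP.biUnion (XA H φ)).card
  have hcr : (PP.biUnion (fun A => (XA H φ A).image (fun x => insert x (A.map φ)))).card
      ≤ ∑ A ∈ PP, (XA H φ A).card :=
    card_biUnion_le.trans (sum_le_sum (fun A _ => card_image_le))
  have hu1 := card_union_le (H.filter (fun e => e ⊆ univ.map φ) ∪
      (PP.biUnion (fun A => (XA H φ A).image (fun x => insert x (A.map φ)))))
      (H.filter (fun e => e ⊆ (univ.map φ)ᶜ \ PP.biUnion (XA H φ)))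
  have hu2 := card_union_le (H.filter (fun e => e ⊆ univ.map φ))
      (PP.biUnion (fun A => (XA H φ A).image (fun x => insert x (A.map φ))))
  have hsub : ∀ A ∈ PP, (XA H φ A).card ≤ (PP.biUnion (XA H φ)).card :=
    fun A hA => card_le_card (subset_biUnion_of_mem (XA H φ) hA)
  set S := PP.filter (fun A => (XA H φ A).Nonempty) with hS
  have hSm : ∀ A, A ∈ S ↔ A ∈ PP ∧ (XA H φ A).Nonempty := fun A => by rw [hS, mem_filter]
  have hsumS : ∑ A ∈ PP, (XA H φ A).card = ∑ A ∈ S, (XA H φ A).card := by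
    rw [hS, sum_filter_of_ne]
    intro A hA h
    exact card_ne_zero.1 h
  have hsumk : ∑ A ∈ S, (XA H φ A).card ≤ S.card * (PP.biUnion (XA H φ)).card := by
    rw [← smul_eq_mul]
    exact sum_le_card_nsmul _ _ _ (fun A hA => hsub A ((hSm A).1 hA).1)
  have hin := inner_le hP h3 hC (φ := φ)
  rw [hsumS] at hs hcr
  generalize (PP.biUnion (XA H φ)).card = t at *
  generalize (∑ A ∈ S, (XA H φ A).card) = σ at *
  have hk : S.card = 0 ∨ S.card = 1 ∨ S.card = 2 ∨ 2 < S.card := by omega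
  rcases hk with hk | hk | hk | hk
  · have := hin (powersetCard 3 univ) (fun g hg _ => hg)
    rw [card_powersetCard] at this
    have h20 : (univ : Finset (Fin 6)).card.choose 3 = 20 := by decide
    rw [hk] at hsumk
    omega
  · obtain ⟨A, hA⟩ := card_eq_one.1 hk
    obtain ⟨hA1, hA2⟩ := (hSm A).1 (by rw [hA]; simp)
    have h1 := hin (good A) (fun g _ h => h A hA1 hA2)
    have := E1 A hA1
    rw [hk] at hsumk
    omega
  · obtain ⟨A, B, hne, hA⟩ := card_eq_two.1 hk
    obtain ⟨hA1, hA2⟩ := (hSm A).1 (by rw [hA]; simp)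
    obtain ⟨hB1, hB2⟩ := (hSm B).1 (by rw [hA]; simp)
    have h1 := hin (good A ∩ good B) (fun g _ h => mem_inter.2 ⟨h A hA1 hA2, h B hB1 hB2⟩)
    have := E2 A hA1 B hB1 hne
    rw [hk] at hsumk
    omega
  · obtain ⟨A, hA, B, hB, D, hD, hAB, hAD, hBD⟩ := two_lt_card.1 hk
    obtain ⟨hA1, hA2⟩ := (hSm A).1 hA
    obtain ⟨hB1, hB2⟩ := (hSm B).1 hB
    obtain ⟨hD1, hD2⟩ := (hSm D).1 hD
    have h1 := hin (good A ∩ good B ∩ good D) (fun g _ h =>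
      mem_inter.2 ⟨mem_inter.2 ⟨h A hA1 hA2, h B hB1 hB2⟩, h D hD1 hD2⟩)
    have := E3 A hA1 B hB1 D hD1 hAB hAD hBD
    omega

lemma upper' (hP : ¬ HasP33 H) (h3 : ∀ e ∈ H, e.card = 3) (hC : HasC33 H) :
    H.card ≤ 20 + ex3P33 (Fintype.card V - 6) := by
  obtain ⟨a, b, c, d, e, f, h6, h1, h2, h4⟩ := hC
  have himg : (univ : Finset (Fin 6)).image ![a, b, c, d, e, f] = {a, b, c, d, e, f} := by
    ext v
    simp [Fin.exists_fin_succ, eq_comm]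
  have hinj : Function.Injective ![a, b, c, d, e, f] := by
    rw [← Set.injOn_univ, ← coe_univ, ← card_image_iff, himg, h6]
    simp
  refine upper (φ := ⟨_, hinj⟩) hP h3 ?_
  intro B hB
  simp only [CC, mem_insert, mem_singleton] at hB
  rcases hB with rfl | rfl | rfl <;> simpa [Finset.map_insert]

end upper

lemma lower (n : ℕ) (hn : 6 ≤ n) : ∃ H : Finset (Finset (Fin n)),
      (∀ e ∈ H, e.card = 3) ∧ ¬ HasP33 H ∧ HasC33 H ∧ H.card = 20 + ex3P33 (n - 6) := by
  obtain ⟨F, hF3, hFP, hFc⟩ := ex_attained (n - 6)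
  let φ : Fin 6 ↪ Fin n := Fin.castLEEmb hn
  let ψ : Fin (n - 6) ↪ Fin n := ⟨fun i => ⟨i.1 + 6, by omega⟩, fun i j h => by
    simp only [Fin.mk.injEq] at h
    exact Fin.ext (by omega)⟩
  have hd : Disjoint (univ.map φ) (univ.map ψ) := by
    rw [Finset.disjoint_left]
    intro v hv hv'
    obtain ⟨i, -, rfl⟩ := mem_map.1 hv
    obtain ⟨j, -, h⟩ := mem_map.1 hv'
    have h' : j.1 + 6 = i.1 := congrArg Fin.val h
    omega
  have hU : (univ.map φ).card = 6 := by simp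
  have hG : ∀ e ∈ F.image (fun e => e.map ψ), e ⊆ univ.map ψ := by
    intro e he
    obtain ⟨f, hf, rfl⟩ := mem_image.1 he
    exact map_subset_map.2 (subset_univ _)
  have hK : ∀ e ∈ powersetCard 3 (univ.map φ), e ⊆ univ.map φ :=
    fun e he => (mem_powersetCard.1 he).1
  have hK3 : ∀ e ∈ powersetCard 3 (univ.map φ), e.card = 3 :=
    fun e he => (mem_powersetCard.1 he).2
  refine ⟨powersetCard 3 (univ.map φ) ∪ F.image (fun e => e.map ψ), ?_, ?_, ?_, ?_⟩
  · intro e he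
    rcases mem_union.1 he with h | h
    · exact hK3 e h
    · obtain ⟨f, hf, rfl⟩ := mem_image.1 h
      rw [card_map]; exact hF3 f hf
  · exact union_free hd hK hG (six_free _ hU) (map_free ψ F hFP)
  · have key : ∀ A : Finset (Fin 6), A.card = 3 →
        A.map φ ∈ powersetCard 3 (univ.map φ) ∪ F.image (fun e => e.map ψ) := by
      intro A hA
      exact mem_union_left _ (mem_powersetCard.2 ⟨map_subset_map.2 (subset_univ _), by simpa⟩)
    refine ⟨φ 0, φ 1, φ 2, φ 3, φ 4, φ 5, ?_, ?_, ?_, ?_⟩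
    · have : ({φ 0, φ 1, φ 2, φ 3, φ 4, φ 5} : Finset (Fin n)) =
          ({0, 1, 2, 3, 4, 5} : Finset (Fin 6)).map φ := by simp [Finset.map_insert]
      rw [this, card_map]; decide
    · simpa [Finset.map_insert] using key {0, 1, 2} (by decide)
    · simpa [Finset.map_insert] using key {2, 3, 4} (by decide)
    · simpa [Finset.map_insert] using key {4, 5, 0} (by decide)
  · rw [card_union_of_disjoint (fam_disj hd hK hG hK3), map_fam_card, hFc, card_powersetCard, hU]
    rfl

end CT

theorem conditional_turan_P33_C33 (n : ℕ) (hn : 6 ≤ n) :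
    IsGreatest {m : ℕ | ∃ H : Finset (Finset (Fin n)),
      (∀ e ∈ H, e.card = 3) ∧ ¬ HasP33 H ∧ HasC33 H ∧ H.card = m}
      (20 + ex3P33 (n - 6)) := by
  refine ⟨CT.lower n hn, ?_⟩
  rintro m ⟨H, h3, hP, hC, rfl⟩
  have := CT.upper' hP h3 hC
  rwa [Fintype.card_fin] at this
end

section
/- For n ≥ 14, the maximum number of edges in an n-vertex P³₃-free 3-graph containing a copy of C³₃ is 20 + C(n-7, 2), achieved uniquely by the disjoint union of K³₆ and a full star S³_{n-6}. -/
section helpers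

variable {V : Type*} [DecidableEq V]

/-- `{a,b,c}` is an edge. -/
def TT (H : Finset (Finset V)) (a b c : V) : Prop := ({a, b, c} : Finset V) ∈ H

theorem TT.s1 {H : Finset (Finset V)} {a b c : V} (h : TT H a b c) : TT H b a c := by
  unfold TT at *; rwa [Finset.insert_comm]

theorem TT.s2 {H : Finset (Finset V)} {a b c : V} (h : TT H a b c) : TT H a c b := by
  unfold TT at *; rwa [Finset.pair_comm]

theorem TT.s3 {H : Finset (Finset V)} {a b c : V} (h : TT H a b c) : TT H b c a := h.s1.s2

theorem TT.s4 {H : Finset (Finset V)} {a b c : V} (h : TT H a b c) : TT H c a b := h.s2.s1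

theorem TT.s5 {H : Finset (Finset V)} {a b c : V} (h : TT H a b c) : TT H c b a := h.s1.s4

theorem TT.ne {H : Finset (Finset V)} (hH : ∀ e ∈ H, e.card = 3) {a b c : V} (h : TT H a b c) :
    a ≠ b ∧ a ≠ c ∧ b ≠ c := by
  have h3 := hH _ h
  refine ⟨?_, ?_, ?_⟩ <;> rintro rfl
  · have := Finset.card_le_two (a := a) (b := c)
    simp at h3; omega
  · have := Finset.card_le_two (a := b) (b := a)
    rw [Finset.insert_comm] at h3
    simp at h3; omega
  · have := Finset.card_le_two (a := a) (b := b)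
    simp at h3; omega

theorem noP {H : Finset (Finset V)} (hP : ¬ HasP33 H) (a b c d e f g : V)
    (h1 : TT H a b c) (h2 : TT H c d e) (h3 : TT H e f g)
    (nd : [a, b, c, d, e, f, g].Nodup) : False := by
  apply hP
  simp only [List.nodup_cons, List.mem_cons, not_or, List.not_mem_nil, not_false_eq_true, and_true,
    List.nodup_nil] at nd
  refine ⟨_, _, _, h1, h2, h3, ?_, ?_, ?_⟩
  · rw [Finset.card_eq_one]; exact ⟨c, by ext t; simp; grind⟩
  · rw [Finset.card_eq_one]; exact ⟨e, by ext t; simp; grind⟩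
  · ext t; simp; grind

theorem noC {H : Finset (Finset V)} (hC : ¬ HasC33 H) (a b c d e f : V)
    (h1 : TT H a b c) (h2 : TT H c d e) (h3 : TT H e f a)
    (nd : [a, b, c, d, e, f].Nodup) : False := by
  apply hC
  refine ⟨a, b, c, d, e, f, ?_, h1, h2, h3⟩
  have := List.toFinset_card_of_nodup nd
  simpa using this

/-- every edge containing `a` is `{a,p,q}` -/
theorem exists_TT {H : Finset (Finset V)} (hH : ∀ e ∈ H, e.card = 3) {e : Finset V} (he : e ∈ H)
    {a : V} (ha : a ∈ e) : ∃ p q, e = {a, p, q} ∧ TT H a p q := by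
  have h3 := hH e he
  have : (e.erase a).card = 2 := by rw [Finset.card_erase_of_mem ha, h3]
  obtain ⟨p, q, hpq, h⟩ := Finset.card_eq_two.1 this
  have h' : e = {a, p, q} := by rw [← h, Finset.insert_erase ha]
  exact ⟨p, q, h', by unfold TT; rwa [← h']⟩

theorem bad1 {H : Finset (Finset V)} (hH : ∀ e ∈ H, e.card = 3) (hP : ¬ HasP33 H)
    (hC : ¬ HasC33 H) {a b c x z : V} (h0 : TT H a b c) (h1 : TT H a b x) (h2 : TT H a c x)
    (n1 : ∀ w, TT H a b w → w = c ∨ w = x) (n2 : ∀ w, TT H a c w → w = b ∨ w = x)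
    (h3 : TT H b c z) (hza : z ≠ a) (hzx : z ≠ x) :
    ∃ v, (∃ e ∈ H, v ∈ e) ∧ (H.filter (fun e => v ∈ e)).card ≤ 5 := by
  have d0 := h0.ne hH
  have d1 := h1.ne hH
  have d2 := h2.ne hH
  have d3 := h3.ne hH
  -- edges at a
  have ea : ∀ p q, p ≠ b → p ≠ c → q ≠ b → q ≠ c → p ≠ x → q ≠ x → ¬ TT H a p q := by
    intro p q hp1 hp2 hq1 hq2 hp3 hq3 h
    have d4 := h.ne hH
    by_cases hpz : p = z
    · subst hpz
      exact noC hC a q p c b x h.s2 h3.s5 h1.s3 (by simp; grind)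
    by_cases hqz : q = z
    · subst hqz
      exact noC hC a p q c b x h h3.s5 h1.s3 (by simp; grind)
    exact noP hP p q a x b c z h.s3 h1.s2 h3 (by simp; grind)
  have ex : ∀ p q, p ≠ b → p ≠ c → q ≠ b → q ≠ c → p ≠ a → q ≠ a → ¬ TT H x p q := by
    intro p q hp1 hp2 hq1 hq2 hp3 hq3 h
    have d4 := h.ne hH
    by_cases hpz : p = z
    · subst hpz
      exact noC hC x q p c b a h.s2 h3.s5 h1.s1 (by simp; grind)
    by_cases hqz : q = z
    · subst hqz
      exact noC hC x p q c b a h h3.s5 h1.s1 (by simp; grind)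
    exact noP hP p q x a b c z h.s3 h1.s4 h3 (by simp; grind)
  by_cases hq : ∃ q, q ≠ b ∧ q ≠ c ∧ TT H a x q
  · obtain ⟨q, hqb, hqc, h⟩ := hq
    have d4 := h.ne hH
    refine ⟨q, ⟨_, h, by simp⟩, ?_⟩
    have key : ∀ p r, TT H q p r → (p = a ∧ r = x) ∨ (p = x ∧ r = a) ∨ (p = b ∧ r = c) ∨
        (p = c ∧ r = b) ∨ (p = x ∧ r = b) ∨ (p = b ∧ r = x) ∨ (p = x ∧ r = c) ∨
        (p = c ∧ r = x) := by
      intro p r hT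
      have d5 := hT.ne hH
      by_cases hpa : p = a
      · subst hpa
        have e1 : r ≠ b := by
          rintro rfl
          have := n1 _ hT.s3
          grind
        have e2 : r ≠ c := by
          rintro rfl
          have := n2 _ hT.s3
          grind
        have := ea q r hqb hqc e1 e2 d4.2.2.symm
        have := hT.s1
        grind
      by_cases hra : r = a
      · subst hra
        have e1 : p ≠ b := by
          rintro rfl
          have := n1 _ hT.s5
          grind
        have e2 : p ≠ c := by
          rintro rfl
          have := n2 _ hT.s5
          grind
        have := ea q p hqb hqc e1 e2 d4.2.2.symm
        have := hT.s4
        grind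
      by_cases hpx : p = x
      · subst hpx
        have := ex q r hqb hqc
        have := hT.s1
        grind
      by_cases hrx : r = x
      · subst hrx
        have := ex q p hqb hqc
        have := hT.s4
        grind
      by_cases hpb : p = b
      · subst hpb
        by_contra hcon
        exact noC hC a c p r q x h0.s2 hT.s3 h.s4.s2 (by simp; grind)
      by_cases hpc : p = c
      · subst hpc
        by_contra hcon
        exact noC hC a b p r q x h0 hT.s3 h.s4.s2 (by simp; grind)
      by_cases hrb : r = b
      · subst hrb
        by_contra hcon
        exact noC hC a c r p q x h0.s2 hT.s5 h.s4.s2 (by simp; grind)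
      by_cases hrc : r = c
      · subst hrc
        by_contra hcon
        exact noC hC a b r p q x h0 hT.s5 h.s4.s2 (by simp; grind)
      exact (noP hP p r q x a b c hT.s3 h.s4.s2 h0 (by simp; grind)).elim
    have hsub : H.filter (fun e => q ∈ e) ⊆ {{q, a, x}, {q, b, c}, {q, x, b}, {q, x, c}} := by
      intro e he
      rw [Finset.mem_filter] at he
      obtain ⟨p, r, rfl, hT⟩ := exists_TT hH he.1 he.2
      simp only [Finset.mem_insert, Finset.mem_singleton]
      rcases key p r hT with ⟨rfl, rfl⟩ | ⟨rfl, rfl⟩ | ⟨rfl, rfl⟩ | ⟨rfl, rfl⟩ | ⟨rfl, rfl⟩ |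
        ⟨rfl, rfl⟩ | ⟨rfl, rfl⟩ | ⟨rfl, rfl⟩ <;> simp [Finset.pair_comm]
    exact (Finset.card_le_card hsub).trans (Finset.card_le_four.trans (by norm_num))
  · refine ⟨a, ⟨_, h0, by simp⟩, ?_⟩
    have hsub : H.filter (fun e => a ∈ e) ⊆ {{a, b, c}, {a, b, x}, {a, c, x}} := by
      intro e he
      rw [Finset.mem_filter] at he
      obtain ⟨p, r, rfl, hT⟩ := exists_TT hH he.1 he.2
      have d5 := hT.ne hH
      have hT' := hT.s2
      have hkey : (p = b ∧ r = c) ∨ (p = c ∧ r = b) ∨ (p = b ∧ r = x) ∨ (p = x ∧ r = b) ∨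
          (p = c ∧ r = x) ∨ (p = x ∧ r = c) := by
        by_cases hpb : p = b
        · subst hpb; have := n1 _ hT; grind
        by_cases hpc : p = c
        · subst hpc; have := n2 _ hT; grind
        by_cases hrb : r = b
        · subst hrb; have := n1 _ hT'; grind
        by_cases hrc : r = c
        · subst hrc; have := n2 _ hT'; grind
        by_cases hpx : p = x
        · subst hpx; exact (hq ⟨r, hrb, hrc, hT⟩).elim
        by_cases hrx : r = x
        · subst hrx; exact (hq ⟨p, hpb, hpc, hT'⟩).elim
        exact (ea p r hpb hpc hrb hrc hpx hrx hT).elim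
      simp only [Finset.mem_insert, Finset.mem_singleton]
      rcases hkey with ⟨rfl, rfl⟩ | ⟨rfl, rfl⟩ | ⟨rfl, rfl⟩ | ⟨rfl, rfl⟩ | ⟨rfl, rfl⟩ |
        ⟨rfl, rfl⟩ <;> simp [Finset.pair_comm]
    exact (Finset.card_le_card hsub).trans (Finset.card_le_three.trans (by norm_num))

theorem bad2 {H : Finset (Finset V)} (hH : ∀ e ∈ H, e.card = 3) (hP : ¬ HasP33 H)
    (hC : ¬ HasC33 H) {a b c x y : V} (h0 : TT H a b c) (hxy : x ≠ y) (hxa : x ≠ a) (hya : y ≠ a)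
    (hbx : TT H b c x) (hby : TT H b c y)
    (n1 : ∀ w, TT H a b w → w = c ∨ w = x ∨ w = y) (n2 : ∀ w, TT H a c w → w = b ∨ w = x ∨ w = y)
    (hx : TT H a b x ∨ TT H a c x) (hy : TT H a b y ∨ TT H a c y) :
    ∀ e ∈ H, a ∈ e → e = {a, b, c} ∨ e = {a, b, x} ∨ e = {a, b, y} ∨ e = {a, c, x} ∨
      e = {a, c, y} ∨ e = {a, x, y} := by
  intro e he hae
  obtain ⟨p, q, rfl, hT⟩ := exists_TT hH he hae
  have d0 := h0.ne hH
  have d1 := hbx.ne hH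
  have d2 := hby.ne hH
  have d3 := hT.ne hH
  have hT' := hT.s2
  have gen : ∀ p q, TT H a p q → p ≠ b → p ≠ c → q ≠ b → q ≠ c → p ≠ y → q ≠ y → False := by
    intro p q hT hpb hpc hqb hqc hpy hqy
    have d3 := hT.ne hH
    by_cases hpx : p = x
    · subst hpx
      rcases hy with hy | hy
      · exact noC hC a q p c b y hT.s2 hbx.s5 hy.s3 (by simp; grind)
      · exact noC hC a q p b c y hT.s2 hbx.s4 hy.s3 (by simp; grind)
    by_cases hqx : q = x
    · subst hqx
      rcases hy with hy | hy
      · exact noC hC a p q c b y hT hbx.s5 hy.s3 (by simp; grind)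
      · exact noC hC a p q b c y hT hbx.s4 hy.s3 (by simp; grind)
    rcases hy with hy | hy
    · exact noP hP p q a y b c x hT.s3 hy.s2 hbx (by simp; grind)
    · exact noP hP p q a y c b x hT.s3 hy.s2 hbx.s1 (by simp; grind)
  have gen2 : ∀ p q, TT H a p q → p ≠ b → p ≠ c → q ≠ b → q ≠ c → q ≠ x → p = y → False := by
    intro p q hT hpb hpc hqb hqc hqx hpy
    subst hpy
    have d3 := hT.ne hH
    rcases hx with hx | hx
    · exact noC hC a q p c b x hT.s2 hby.s5 hx.s3 (by simp; grind)
    · exact noC hC a q p b c x hT.s2 hby.s4 hx.s3 (by simp; grind)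
  have key : (p = b ∧ (q = c ∨ q = x ∨ q = y)) ∨ (q = b ∧ (p = c ∨ p = x ∨ p = y)) ∨
      (p = c ∧ (q = x ∨ q = y)) ∨ (q = c ∧ (p = x ∨ p = y)) ∨ (p = x ∧ q = y) ∨
      (p = y ∧ q = x) := by
    by_cases hpb : p = b
    · subst hpb; have := n1 _ hT; grind
    by_cases hpc : p = c
    · subst hpc; have := n2 _ hT; grind
    by_cases hrb : q = b
    · subst hrb; have := n1 _ hT'; grind
    by_cases hrc : q = c
    · subst hrc; have := n2 _ hT'; grind
    have := gen p q hT hpb hpc hrb hrc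
    have := gen2 p q hT hpb hpc hrb hrc
    have := gen2 q p hT' hrb hrc hpb hpc
    grind
  rcases key with ⟨rfl, rfl | rfl | rfl⟩ | ⟨rfl, rfl | rfl | rfl⟩ | ⟨rfl, rfl | rfl⟩ |
    ⟨rfl, rfl | rfl⟩ | ⟨rfl, rfl⟩ | ⟨rfl, rfl⟩ <;> simp [Finset.pair_comm]


theorem sdr_lemma {X Y Z : V → Prop} (hX : ∃ x, X x) (hY : ∃ x, Y x) (hZ : ∃ x, Z x)
    (no : ∀ x y z, X x → Y y → Z z → x ≠ y → y ≠ z → x ≠ z → False)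
    (hXY : ¬ ∃ x, (∀ w, X w → w = x) ∧ (∀ w, Y w → w = x))
    (hYZ : ¬ ∃ x, (∀ w, Y w → w = x) ∧ (∀ w, Z w → w = x))
    (hXZ : ¬ ∃ x, (∀ w, X w → w = x) ∧ (∀ w, Z w → w = x)) :
    ∃ x y, x ≠ y ∧ (∀ w, X w → w = x ∨ w = y) ∧ (∀ w, Y w → w = x ∨ w = y) ∧
      (∀ w, Z w → w = x ∨ w = y) ∧ ((X x ∧ X y) ∨ (Y x ∧ Y y) ∨ (Z x ∧ Z y)) := by
  have key : ∀ {X Y : V → Prop}, (∃ x, X x) → (∃ x, Y x) →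
      (¬ ∃ x, (∀ w, X w → w = x) ∧ (∀ w, Y w → w = x)) → ∃ x y, X x ∧ Y y ∧ x ≠ y := by
    intro X Y ⟨x, hx⟩ ⟨y, hy⟩ h
    by_contra hcon
    push Not at hcon
    refine h ⟨y, fun w hw => hcon w y hw hy, fun w hw => ?_⟩
    rw [← hcon x w hx hw, hcon x y hx hy]
  obtain ⟨x, y, hx, hy, hne⟩ := key hX hY hXY
  obtain ⟨y', z', hy', hz', hne'⟩ := key hY hZ hYZ
  obtain ⟨x'', z'', hx'', hz'', hne''⟩ := key hX hZ hXZ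
  have hZs : ∀ w, Z w → w = x ∨ w = y := by
    intro w hw
    by_contra hcon
    exact no x y w hx hy hw hne (by grind) (by grind)
  have hXs' : ∀ w, X w → w = y' ∨ w = z' := by
    intro w hw
    by_contra hcon
    exact no w y' z' hw hy' hz' (by grind) (by grind) (by grind)
  have hYs' : ∀ w, Y w → w = x'' ∨ w = z'' := by
    intro w hw
    by_contra hcon
    exact no x'' w z'' hx'' hw hz'' (by grind) (by grind) (by grind)
  have hXs : ∀ w, X w → w = x ∨ w = y := by
    intro w hw
    by_contra hcon
    rw [not_or] at hcon
    rcases hZs z' hz' with h | h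
    · subst h
      exact no w y z' hw hy hz' hcon.2 hne.symm hcon.1
    · by_cases h' : y' = x
      · subst h'
        exact no w y' z' hw hy' hz' hcon.1 hne' (h ▸ hcon.2)
      · exact no x y' z' hx hy' hz' (Ne.symm h') hne' (h ▸ hne)
  have hYs : ∀ w, Y w → w = x ∨ w = y := by
    intro w hw
    rcases hYs' w hw with rfl | rfl
    · exact hXs _ hx''
    · exact hZs _ hz''
  refine ⟨x, y, hne, hXs, hYs, hZs, ?_⟩
  by_contra hcon
  obtain ⟨z, hz⟩ := hZ
  rcases hZs z hz with rfl | rfl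
  · apply hXZ
    clear hXY hYZ hXZ no
    exact ⟨z, by grind, by grind⟩
  · apply hYZ
    clear hXY hYZ hXZ no
    exact ⟨z, by grind, by grind⟩

/-- Conclusion for edges where all pairs have codegree at least two. -/
def LowDeg (H : Finset (Finset V)) : Prop :=
  (∃ v, (∃ e ∈ H, v ∈ e) ∧ (H.filter (fun e => v ∈ e)).card ≤ 5) ∨
  (∃ a b c, TT H a b c ∧ (H.filter (fun e => a ∈ e)).card ≤ 6 ∧
    (H.filter (fun e => ¬ Disjoint e {a, b, c})).card ≤ 10)

theorem bad3 {H : Finset (Finset V)} (hH : ∀ e ∈ H, e.card = 3) (hP : ¬ HasP33 H)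
    (hC : ¬ HasC33 H) {a b c x y : V} (h0 : TT H a b c) (hxy : x ≠ y) (hxa : x ≠ a) (hya : y ≠ a)
    (hbx : TT H b c x) (hby : TT H b c y)
    (n1 : ∀ w, TT H a b w → w = c ∨ w = x ∨ w = y) (n2 : ∀ w, TT H a c w → w = b ∨ w = x ∨ w = y)
    (n3 : ∀ w, TT H b c w → w = a ∨ w = x ∨ w = y)
    (hx : TT H a b x ∨ TT H a c x) (hy : TT H a b y ∨ TT H a c y) : LowDeg H := by
  have d0 := h0.ne hH
  have d1 := hbx.ne hH
  have d2 := hby.ne hH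
  have ha := bad2 hH hP hC h0 hxy hxa hya hbx hby n1 n2 hx hy
  have hv : ∃ e ∈ H, a ∈ e := ⟨_, h0, by simp⟩
  by_cases h1 : TT H a b x
  swap
  · left
    refine ⟨a, hv, (Finset.card_le_card (t := {{a, b, c}, {a, b, y}, {a, c, x}, {a, c, y}, {a, x, y}})
      ?_).trans Finset.card_le_five⟩
    intro e he
    rw [Finset.mem_filter] at he
    have := ha e he.1 he.2
    have h' : e ≠ {a, b, x} := fun h => h1 (by unfold TT; rw [← h]; exact he.1)
    simp only [Finset.mem_insert, Finset.mem_singleton]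
    rcases this with h | h | h | h | h | h <;>
      first
        | exact absurd h h'
        | simp only [h, true_or, or_true]
  by_cases h2 : TT H a b y
  swap
  · left
    refine ⟨a, hv, (Finset.card_le_card (t := {{a, b, c}, {a, b, x}, {a, c, x}, {a, c, y}, {a, x, y}})
      ?_).trans Finset.card_le_five⟩
    intro e he
    rw [Finset.mem_filter] at he
    have := ha e he.1 he.2
    have h' : e ≠ {a, b, y} := fun h => h2 (by unfold TT; rw [← h]; exact he.1)
    simp only [Finset.mem_insert, Finset.mem_singleton]
    rcases this with h | h | h | h | h | h <;>
      first
        | exact absurd h h'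
        | simp only [h, true_or, or_true]
  by_cases h3 : TT H a c x
  swap
  · left
    refine ⟨a, hv, (Finset.card_le_card (t := {{a, b, c}, {a, b, x}, {a, b, y}, {a, c, y}, {a, x, y}})
      ?_).trans Finset.card_le_five⟩
    intro e he
    rw [Finset.mem_filter] at he
    have := ha e he.1 he.2
    have h' : e ≠ {a, c, x} := fun h => h3 (by unfold TT; rw [← h]; exact he.1)
    simp only [Finset.mem_insert, Finset.mem_singleton]
    rcases this with h | h | h | h | h | h <;>
      first
        | exact absurd h h'
        | simp only [h, true_or, or_true]
  by_cases h4 : TT H a c y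
  swap
  · left
    refine ⟨a, hv, (Finset.card_le_card (t := {{a, b, c}, {a, b, x}, {a, b, y}, {a, c, x}, {a, x, y}})
      ?_).trans Finset.card_le_five⟩
    intro e he
    rw [Finset.mem_filter] at he
    have := ha e he.1 he.2
    have h' : e ≠ {a, c, y} := fun h => h4 (by unfold TT; rw [← h]; exact he.1)
    simp only [Finset.mem_insert, Finset.mem_singleton]
    rcases this with h | h | h | h | h | h <;>
      first
        | exact absurd h h'
        | simp only [h, true_or, or_true]
  have hb := bad2 hH hP hC h0.s1 hxy d1.2.1.symm d2.2.1.symm h3 h4 (fun w hw => n1 w hw.s1) n3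
    (Or.inl h1.s1) (Or.inl h2.s1)
  have hc := bad2 hH hP hC h0.s4 hxy d1.2.2.symm d2.2.2.symm h1 h2 (fun w hw => n2 w hw.s1)
    (fun w hw => n3 w hw.s1) (Or.inl h3.s1) (Or.inl h4.s1)
  right
  refine ⟨a, b, c, h0, (Finset.card_le_card
    (t := {{a, b, c}, {a, b, x}, {a, b, y}, {a, c, x}, {a, c, y}, {a, x, y}})
      ?_).trans Finset.card_le_six, ?_⟩
  · intro e he
    rw [Finset.mem_filter] at he
    have := ha e he.1 he.2
    simp only [Finset.mem_insert, Finset.mem_singleton]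
    exact this
  · have : (Finset.powersetCard 3 ({a, b, c, x, y} : Finset V)).card ≤ 10 := by
      rw [Finset.card_powersetCard]
      exact (Nat.choose_le_choose 3 Finset.card_le_five).trans (by decide)
    refine (Finset.card_le_card ?_).trans this
    intro e he
    rw [Finset.mem_filter] at he
    rw [Finset.mem_powersetCard]
    refine ⟨?_, hH e he.1⟩
    have hd := he.2
    rw [Finset.not_disjoint_iff] at hd
    obtain ⟨t, hte, ht⟩ := hd
    simp only [Finset.mem_insert, Finset.mem_singleton] at ht
    rcases ht with rfl | rfl | rfl
    · rcases ha e he.1 hte with rfl | rfl | rfl | rfl | rfl | rfl <;>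
        simp [Finset.insert_subset_iff]
    · rcases hb e he.1 hte with rfl | rfl | rfl | rfl | rfl | rfl <;>
        simp [Finset.insert_subset_iff]
    · rcases hc e he.1 hte with rfl | rfl | rfl | rfl | rfl | rfl <;>
        simp [Finset.insert_subset_iff]

/-- An edge one of whose pairs has codegree one, or whose pairs all have codegree at most two. -/
def GoodE (H : Finset (Finset V)) (a b c : V) : Prop :=
  (∀ w, TT H b c w → w = a) ∨ (∀ w, TT H a c w → w = b) ∨ (∀ w, TT H a b w → w = c) ∨
  (∃ x, (∀ w, TT H b c w → w = a ∨ w = x) ∧ (∀ w, TT H a c w → w = b ∨ w = x) ∧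
    (∀ w, TT H a b w → w = c ∨ w = x))

theorem badS {H : Finset (Finset V)} (hH : ∀ e ∈ H, e.card = 3) (hP : ¬ HasP33 H)
    (hC : ¬ HasC33 H) {a b c : V} (h0 : TT H a b c)
    (hX : ∃ w, TT H a b w ∧ w ≠ c) (hY : ∃ w, TT H a c w ∧ w ≠ b)
    (hG : ¬ (∃ x, (∀ w, TT H b c w → w = a ∨ w = x) ∧ (∀ w, TT H a c w → w = b ∨ w = x) ∧
    (∀ w, TT H a b w → w = c ∨ w = x)))
    (h : ∃ x, (∀ w, TT H a b w ∧ w ≠ c → w = x) ∧ (∀ w, TT H a c w ∧ w ≠ b → w = x)) :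
    LowDeg H := by
  obtain ⟨x, h1, h2⟩ := h
  obtain ⟨u, hu⟩ := hX
  obtain ⟨v, hv⟩ := hY
  obtain rfl := h1 u hu
  obtain rfl := h2 v hv
  have n1 : ∀ w, TT H a b w → w = c ∨ w = v := fun w hw => by
    by_cases h : w = c
    · exact Or.inl h
    · exact Or.inr (h1 w ⟨hw, h⟩)
  have n2 : ∀ w, TT H a c w → w = b ∨ w = v := fun w hw => by
    by_cases h : w = b
    · exact Or.inl h
    · exact Or.inr (h2 w ⟨hw, h⟩)
  have : ∃ z, TT H b c z ∧ z ≠ a ∧ z ≠ v := by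
    by_contra hcon
    push Not at hcon
    apply hG
    refine ⟨v, ?_, n2, n1⟩
    intro w hw
    have := hcon w hw
    tauto
  obtain ⟨z, hz, hza, hzv⟩ := this
  exact Or.inl (bad1 hH hP hC h0 hu.1 hv.1 n1 n2 hz hza hzv)

theorem bad_main {H : Finset (Finset V)} (hH : ∀ e ∈ H, e.card = 3) (hP : ¬ HasP33 H)
    (hC : ¬ HasC33 H) {a b c : V} (h0 : TT H a b c) (hG : ¬ GoodE H a b c) : LowDeg H := by
  unfold GoodE at hG
  push Not at hG
  obtain ⟨hZ, hY, hX, hG⟩ := hG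
  have d0 := h0.ne hH
  have hG' : ¬ (∃ x, (∀ w, TT H b c w → w = a ∨ w = x) ∧ (∀ w, TT H a c w → w = b ∨ w = x) ∧
    (∀ w, TT H a b w → w = c ∨ w = x)) := by
    rintro ⟨x, h1, h2, h3⟩
    obtain ⟨w, hw⟩ := hG x h1 h2
    have := h3 w hw.1
    tauto
  have c1 : ∀ {p q r}, TT H p q r → TT H q p r := fun h => h.s1
  by_cases s1 : ∃ x, (∀ w, TT H a b w ∧ w ≠ c → w = x) ∧ (∀ w, TT H a c w ∧ w ≠ b → w = x)
  · exact badS hH hP hC h0 hX hY hG' s1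
  by_cases s2 : ∃ x, (∀ w, TT H a b w ∧ w ≠ c → w = x) ∧ (∀ w, TT H b c w ∧ w ≠ a → w = x)
  · refine badS hH hP hC h0.s1 (hX.imp fun w hw => ⟨hw.1.s1, hw.2⟩) hZ ?_
      (s2.imp fun x hx => ⟨fun w hw => hx.1 w ⟨hw.1.s1, hw.2⟩, hx.2⟩)
    rintro ⟨x, h1, h2, h3⟩
    exact hG' ⟨x, h2, h1, fun w hw => h3 w hw.s1⟩
  by_cases s3 : ∃ x, (∀ w, TT H a c w ∧ w ≠ b → w = x) ∧ (∀ w, TT H b c w ∧ w ≠ a → w = x)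
  · refine badS hH hP hC h0.s4 (hY.imp fun w hw => ⟨hw.1.s1, hw.2⟩)
      (hZ.imp fun w hw => ⟨hw.1.s1, hw.2⟩) ?_
      (s3.imp fun x hx => ⟨fun w hw => hx.1 w ⟨hw.1.s1, hw.2⟩, fun w hw => hx.2 w ⟨hw.1.s1, hw.2⟩⟩)
    rintro ⟨x, h1, h2, h3⟩
    exact hG' ⟨x, fun w hw => h2 w hw.s1, fun w hw => h3 w hw.s1, h1⟩
  obtain ⟨x, y, hxy, gX, gY, gZ, hall⟩ := sdr_lemma (X := fun w => TT H a b w ∧ w ≠ c)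
    (Y := fun w => TT H a c w ∧ w ≠ b) (Z := fun w => TT H b c w ∧ w ≠ a) hX hY hZ
    (by
      rintro u v w ⟨hu, hu'⟩ ⟨hv, hv'⟩ ⟨hw, hw'⟩ e1 e2 e3
      have d1 := hu.ne hH
      have d2 := hv.ne hH
      have d3 := hw.ne hH
      exact noC hC a u b w c v hu.s2 hw.s2 hv.s3 (by simp; grind)) s1 s3 s2
  have n1 : ∀ w, TT H a b w → w = c ∨ w = x ∨ w = y := fun w hw => by
    by_cases h : w = c
    · exact Or.inl h
    · exact Or.inr (gX w ⟨hw, h⟩)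
  have n2 : ∀ w, TT H a c w → w = b ∨ w = x ∨ w = y := fun w hw => by
    by_cases h : w = b
    · exact Or.inl h
    · exact Or.inr (gY w ⟨hw, h⟩)
  have n3 : ∀ w, TT H b c w → w = a ∨ w = x ∨ w = y := fun w hw => by
    by_cases h : w = a
    · exact Or.inl h
    · exact Or.inr (gZ w ⟨hw, h⟩)
  rcases hall with ⟨⟨h1, h1'⟩, h2, h2'⟩ | ⟨⟨h1, h1'⟩, h2, h2'⟩ | ⟨⟨h1, h1'⟩, h2, h2'⟩
  · refine bad3 hH hP hC h0.s4 hxy h1' h2' h1 h2 (fun w hw => n2 w hw.s1) (fun w hw => n3 w hw.s1)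
      n1 ?_ ?_
    · by_contra hcon
      refine s3 ⟨y, fun w hw => ?_, fun w hw => ?_⟩
      · rcases gY w hw with rfl | rfl
        · exact (hcon (Or.inl hw.1.s1)).elim
        · rfl
      · rcases gZ w hw with rfl | rfl
        · exact (hcon (Or.inr hw.1.s1)).elim
        · rfl
    · by_contra hcon
      refine s3 ⟨x, fun w hw => ?_, fun w hw => ?_⟩
      · rcases gY w hw with rfl | rfl
        · rfl
        · exact (hcon (Or.inl hw.1.s1)).elim
      · rcases gZ w hw with rfl | rfl
        · rfl
        · exact (hcon (Or.inr hw.1.s1)).elim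
  · refine bad3 hH hP hC h0.s1 hxy h1' h2' h1 h2 (fun w hw => n1 w hw.s1) n3 n2 ?_ ?_
    · by_contra hcon
      refine s2 ⟨y, fun w hw => ?_, fun w hw => ?_⟩
      · rcases gX w hw with rfl | rfl
        · exact (hcon (Or.inl hw.1.s1)).elim
        · rfl
      · rcases gZ w hw with rfl | rfl
        · exact (hcon (Or.inr hw.1)).elim
        · rfl
    · by_contra hcon
      refine s2 ⟨x, fun w hw => ?_, fun w hw => ?_⟩
      · rcases gX w hw with rfl | rfl
        · rfl
        · exact (hcon (Or.inl hw.1.s1)).elim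
      · rcases gZ w hw with rfl | rfl
        · rfl
        · exact (hcon (Or.inr hw.1)).elim
  · refine bad3 hH hP hC h0 hxy h1' h2' h1 h2 n1 n2 n3 ?_ ?_
    · by_contra hcon
      refine s1 ⟨y, fun w hw => ?_, fun w hw => ?_⟩
      · rcases gX w hw with rfl | rfl
        · exact (hcon (Or.inl hw.1)).elim
        · rfl
      · rcases gY w hw with rfl | rfl
        · exact (hcon (Or.inr hw.1)).elim
        · rfl
    · by_contra hcon
      refine s1 ⟨x, fun w hw => ?_, fun w hw => ?_⟩
      · rcases gX w hw with rfl | rfl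
        · rfl
        · exact (hcon (Or.inl hw.1)).elim
      · rcases gY w hw with rfl | rfl
        · rfl
        · exact (hcon (Or.inr hw.1)).elim


/-- codegree of a set -/
def codeg (H : Finset (Finset V)) (p : Finset V) : ℕ := (H.filter (fun e => p ⊆ e)).card

theorem TT_of_pair {H : Finset (Finset V)} (hH : ∀ e ∈ H, e.card = 3) {e : Finset V} (he : e ∈ H)
    {a b : V} (hab : a ≠ b) (ha : a ∈ e) (hb : b ∈ e) : ∃ w, e = {a, b, w} ∧ TT H a b w := by
  obtain ⟨p, q, rfl, hT⟩ := exists_TT hH he ha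
  simp only [Finset.mem_insert, Finset.mem_singleton] at hb
  rcases hb with rfl | rfl | rfl
  · exact absurd rfl hab
  · exact ⟨q, rfl, hT⟩
  · exact ⟨p, by rw [Finset.pair_comm], hT.s2⟩

theorem codeg_sub {H : Finset (Finset V)} (hH : ∀ e ∈ H, e.card = 3) {a b : V} (hab : a ≠ b)
    {Z : Finset V} (hZ : ∀ w, TT H a b w → w ∈ Z) :
    H.filter (fun e => {a, b} ⊆ e) ⊆ Z.image (fun w => {a, b, w}) := by
  intro e he
  rw [Finset.mem_filter] at he
  obtain ⟨w, h, hT⟩ := TT_of_pair hH he.1 hab (he.2 (by simp)) (he.2 (by simp))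
  rw [Finset.mem_image]
  exact ⟨w, hZ w hT, h.symm⟩

theorem codeg_le {H : Finset (Finset V)} (hH : ∀ e ∈ H, e.card = 3) {a b : V} (hab : a ≠ b)
    {Z : Finset V} (hZ : ∀ w, TT H a b w → w ∈ Z) : codeg H {a, b} ≤ Z.card :=
  (Finset.card_le_card (codeg_sub hH hab hZ)).trans Finset.card_image_le

theorem codeg_pos {H : Finset (Finset V)} {a b c : V} (h : TT H a b c) : 1 ≤ codeg H {a, b} := by
  unfold codeg
  rw [Nat.one_le_iff_ne_zero, Finset.card_ne_zero]
  exact ⟨_, Finset.mem_filter.2 ⟨h, by simp [Finset.insert_subset_iff]⟩⟩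

theorem mem_A {H : Finset (Finset V)} {A : Finset V} (hA : ∀ e ∈ H, e ⊆ A) {a b c : V}
    (h : TT H a b c) : a ∈ A ∧ b ∈ A ∧ c ∈ A :=
  ⟨hA _ h (by simp), hA _ h (by simp), hA _ h (by simp)⟩

theorem codeg_le_max {H : Finset (Finset V)} (hH : ∀ e ∈ H, e.card = 3) {A : Finset V}
    (hA : ∀ e ∈ H, e ⊆ A) {a b c : V} (h : TT H a b c) : codeg H {a, b} ≤ A.card - 2 := by
  have d := h.ne hH
  have m := mem_A hA h
  have : (A \ {a, b}).card = A.card - 2 := by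
    rw [Finset.card_sdiff_of_subset (by simp [Finset.insert_subset_iff, m]), Finset.card_pair d.1]
  rw [← this]
  apply codeg_le hH d.1
  intro w hw
  have := hw.ne hH
  have := mem_A hA hw
  simp; grind

theorem all_of_codeg {H : Finset (Finset V)} (hH : ∀ e ∈ H, e.card = 3) {A : Finset V}
    (hA : ∀ e ∈ H, e ⊆ A) {a b c : V} (h : TT H a b c) (hc : codeg H {a, b} = A.card - 2) :
    ∀ z ∈ A, z ≠ a → z ≠ b → TT H a b z := by
  have d := h.ne hH
  have m := mem_A hA h
  have hcard : (A \ {a, b}).card = A.card - 2 := by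
    rw [Finset.card_sdiff_of_subset (by simp [Finset.insert_subset_iff, m]), Finset.card_pair d.1]
  have hsub : H.filter (fun e => {a, b} ⊆ e) ⊆ (A \ {a, b}).image (fun w => {a, b, w}) := by
    apply codeg_sub hH d.1
    intro w hw
    have := hw.ne hH
    have := mem_A hA hw
    simp; grind
  have heq := Finset.eq_of_subset_of_card_le hsub (by
    refine Finset.card_image_le.trans ?_
    rw [hcard, ← hc]; rfl)
  intro z hz hza hzb
  have : ({a, b, z} : Finset V) ∈ H.filter (fun e => {a, b} ⊆ e) := by
    rw [heq, Finset.mem_image]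
    exact ⟨z, by simp [hz, hza, hzb], rfl⟩
  exact (Finset.mem_filter.1 this).1

/-- weight of an edge -/
def wt (H : Finset (Finset V)) (e : Finset V) : ℚ := ∑ p ∈ e.powersetCard 2, ((codeg H p : ℚ))⁻¹

theorem wt_eq {H : Finset (Finset V)} (hH : ∀ e ∈ H, e.card = 3) {a b c : V} (h : TT H a b c) :
    wt H {a, b, c} = (codeg H {b, c} : ℚ)⁻¹ + (codeg H {a, c} : ℚ)⁻¹ + (codeg H {a, b} : ℚ)⁻¹ := by
  have d := h.ne hH
  have : Finset.powersetCard 2 ({a, b, c} : Finset V) = {{b, c}, {a, c}, {a, b}} := by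
    symm
    apply Finset.eq_of_subset_of_card_le
    · intro p hp
      simp only [Finset.mem_insert, Finset.mem_singleton] at hp
      rw [Finset.mem_powersetCard]
      rcases hp with rfl | rfl | rfl
      · exact ⟨by simp [Finset.insert_subset_iff], Finset.card_pair d.2.2⟩
      · exact ⟨by simp [Finset.insert_subset_iff], Finset.card_pair d.2.1⟩
      · exact ⟨by simp [Finset.insert_subset_iff], Finset.card_pair d.1⟩
    · rw [Finset.card_powersetCard, hH _ h, Finset.card_eq_three.2 ⟨_, _, _, ?_, ?_, ?_, rfl⟩]
      · decide
      · intro h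
        have : a ∈ ({b, c} : Finset V) := by rw [h]; simp
        simp at this; tauto
      · intro h
        have : a ∈ ({b, c} : Finset V) := by rw [h]; simp
        simp at this; tauto
      · intro h
        have : c ∈ ({a, b} : Finset V) := by rw [← h]; simp
        simp at this; grind
  have n1 : ({b, c} : Finset V) ≠ {a, c} := by
    intro h
    have : a ∈ ({b, c} : Finset V) := by rw [h]; simp
    simp at this; tauto
  have n2 : ({b, c} : Finset V) ≠ {a, b} := by
    intro h
    have : a ∈ ({b, c} : Finset V) := by rw [h]; simp
    simp at this; tauto
  have n3 : ({a, c} : Finset V) ≠ {a, b} := by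
    intro h
    have : c ∈ ({a, b} : Finset V) := by rw [← h]; simp
    simp at this; grind
  unfold wt
  rw [this, Finset.sum_insert (by simp [n1, n2]), Finset.sum_insert (by simp [n3]),
    Finset.sum_singleton]
  ring

theorem sum_wt {H : Finset (Finset V)} {A : Finset V} (hA : ∀ e ∈ H, e ⊆ A) :
    ∑ e ∈ H, wt H e ≤ (A.card.choose 2 : ℚ) := by
  unfold wt
  rw [Finset.sum_comm' (t' := A.powersetCard 2) (s' := fun p => H.filter (fun e => p ⊆ e))]
  · rw [← Finset.card_powersetCard]
    have : ∀ p ∈ A.powersetCard 2, ∑ e ∈ H.filter (fun e => p ⊆ e), (codeg H p : ℚ)⁻¹ ≤ 1 := by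
      intro p _
      rw [Finset.sum_const, nsmul_eq_mul]
      exact mul_inv_le_one
    refine (Finset.sum_le_sum this).trans ?_
    simp
  · intro e p
    simp only [Finset.mem_powersetCard, Finset.mem_filter]
    constructor
    · rintro ⟨h1, h2, h3⟩
      exact ⟨⟨h1, h2⟩, h2.trans (hA e h1), h3⟩
    · rintro ⟨⟨h1, h2⟩, h3, h4⟩
      exact ⟨h1, h2, h4⟩

/-- weight bound when a codegree is one -/
theorem wt_one {M : ℕ} {x y z : ℕ} (hM : 1 ≤ M) (hx : x ≤ 1) (hx1 : 1 ≤ x) (hy1 : 1 ≤ y)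
    (hz1 : 1 ≤ z) (hy : y ≤ M) (hz : z ≤ M) :
    1 + 2 / (M : ℚ) ≤ (x : ℚ)⁻¹ + (y : ℚ)⁻¹ + (z : ℚ)⁻¹ ∧
    ((x : ℚ)⁻¹ + (y : ℚ)⁻¹ + (z : ℚ)⁻¹ = 1 + 2 / (M : ℚ) → y = M ∧ z = M) := by
  obtain rfl : x = 1 := by omega
  have h1 : (M : ℚ)⁻¹ ≤ (y : ℚ)⁻¹ := by gcongr
  have h2 : (M : ℚ)⁻¹ ≤ (z : ℚ)⁻¹ := by gcongr
  have h3 : 2 / (M : ℚ) = (M : ℚ)⁻¹ + (M : ℚ)⁻¹ := by ring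
  rw [h3]
  refine ⟨by push_cast; linarith [inv_one (G := ℚ)], fun h => ?_⟩
  push_cast at h
  rw [inv_one] at h
  have e1 : (y : ℚ)⁻¹ = (M : ℚ)⁻¹ := by linarith
  have e2 : (z : ℚ)⁻¹ = (M : ℚ)⁻¹ := by linarith
  exact ⟨by exact_mod_cast inv_injective e1, by exact_mod_cast inv_injective e2⟩

theorem wt_two {M : ℕ} {x y z : ℕ} (hM : 5 ≤ M) (hx1 : 1 ≤ x) (hy1 : 1 ≤ y)
    (hz1 : 1 ≤ z) (hx : x ≤ 2) (hy : y ≤ 2) (hz : z ≤ 2) :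
    1 + 2 / (M : ℚ) < (x : ℚ)⁻¹ + (y : ℚ)⁻¹ + (z : ℚ)⁻¹ := by
  have h1 : (2 : ℚ)⁻¹ ≤ (y : ℚ)⁻¹ := by gcongr; exact_mod_cast hy
  have h2 : (2 : ℚ)⁻¹ ≤ (z : ℚ)⁻¹ := by gcongr; exact_mod_cast hz
  have h4 : (2 : ℚ)⁻¹ ≤ (x : ℚ)⁻¹ := by gcongr; exact_mod_cast hx
  have h3 : 2 / (M : ℚ) ≤ 2 / 5 := by gcongr; exact_mod_cast hM
  norm_num at *
  linarith

theorem good_wt {H : Finset (Finset V)} (hH : ∀ e ∈ H, e.card = 3) {A : Finset V}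
    (hA : ∀ e ∈ H, e ⊆ A) (hm : 7 ≤ A.card) {a b c : V} (h : TT H a b c) (hG : GoodE H a b c) :
    1 + 2 / ((A.card - 2 : ℕ) : ℚ) ≤ wt H {a, b, c} ∧
    (wt H {a, b, c} = 1 + 2 / ((A.card - 2 : ℕ) : ℚ) →
      ∃ u v w, ({a, b, c} : Finset V) = {u, v, w} ∧ (∀ t, TT H v w t → t = u) ∧
        codeg H {u, v} = A.card - 2 ∧ codeg H {u, w} = A.card - 2) := by
  have d := h.ne hH
  have p1 := codeg_pos h
  have p2 := codeg_pos h.s2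
  have p3 := codeg_pos h.s3
  have m1 := codeg_le_max hH hA h
  have m2 := codeg_le_max hH hA h.s2
  have m3 := codeg_le_max hH hA h.s3
  have hM : 1 ≤ A.card - 2 := by omega
  rw [wt_eq hH h]
  rcases hG with hG | hG | hG | ⟨x, g1, g2, g3⟩
  · have k : codeg H {b, c} ≤ 1 := codeg_le hH d.2.2 (Z := {a}) (by simpa using hG)
    have := wt_one hM k p3 p2 p1 m2 m1
    refine ⟨this.1, fun h' => ⟨a, b, c, rfl, hG, (this.2 h').2, (this.2 h').1⟩⟩
  · have k : codeg H {a, c} ≤ 1 := codeg_le hH d.2.1 (Z := {b}) (by simpa using hG)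
    have := wt_one hM k p2 p3 p1 m3 m1
    rw [add_comm ((codeg H {b, c} : ℚ)⁻¹)]
    refine ⟨this.1, fun h' => ⟨b, a, c, by rw [Finset.insert_comm], hG, ?_, (this.2 h').1⟩⟩
    rw [Finset.pair_comm]
    exact (this.2 h').2
  · have k : codeg H {a, b} ≤ 1 := codeg_le hH d.1 (Z := {c}) (by simpa using hG)
    have := wt_one hM k p1 p3 p2 m3 m2
    have e : (codeg H {b, c} : ℚ)⁻¹ + (codeg H {a, c} : ℚ)⁻¹ + (codeg H {a, b} : ℚ)⁻¹ =
      (codeg H {a, b} : ℚ)⁻¹ + (codeg H {b, c} : ℚ)⁻¹ + (codeg H {a, c} : ℚ)⁻¹ := by ring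
    rw [e]
    refine ⟨this.1, fun h' => ⟨c, a, b, ?_, hG, ?_, ?_⟩⟩
    · ext t; simp; tauto
    · rw [Finset.pair_comm]
      exact (this.2 h').2
    · rw [Finset.pair_comm]
      exact (this.2 h').1
  · have k1 : codeg H {b, c} ≤ 2 := (codeg_le hH d.2.2 (Z := {a, x}) (by simpa using g1)).trans
      Finset.card_le_two
    have k2 : codeg H {a, c} ≤ 2 := (codeg_le hH d.2.1 (Z := {b, x}) (by simpa using g2)).trans
      Finset.card_le_two
    have k3 : codeg H {a, b} ≤ 2 := (codeg_le hH d.1 (Z := {c, x}) (by simpa using g3)).trans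
      Finset.card_le_two
    have := wt_two (M := A.card - 2) (by omega) p3 p2 p1 k1 k2 k3
    exact ⟨this.le, fun h' => absurd h' this.ne'⟩

theorem star_card {A : Finset V} {v : V} (hv : v ∈ A) :
    ((A.powersetCard 3).filter (fun e => v ∈ e)).card = (A.card - 1).choose 2 := by
  rw [← Finset.card_erase_of_mem hv, ← Finset.card_powersetCard]
  symm
  apply Finset.card_bij (fun p _ => insert v p)
  · intro p hp
    rw [Finset.mem_powersetCard] at hp
    have hvp : v ∉ p := fun h => by simpa using hp.1 h
    simp only [Finset.mem_filter, Finset.mem_powersetCard, Finset.mem_insert_self, and_true]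
    exact ⟨Finset.insert_subset hv (hp.1.trans (Finset.erase_subset _ _)),
      by rw [Finset.card_insert_of_notMem hvp, hp.2]⟩
  · intro p hp q hq h
    rw [Finset.mem_powersetCard] at hp hq
    have hvp : v ∉ p := fun h => by simpa using hp.1 h
    have hvq : v ∉ q := fun h => by simpa using hq.1 h
    rw [← Finset.erase_insert hvp, h, Finset.erase_insert hvq]
  · intro e he
    simp only [Finset.mem_filter, Finset.mem_powersetCard] at he
    refine ⟨e.erase v, ?_, Finset.insert_erase he.2⟩
    rw [Finset.mem_powersetCard, Finset.card_erase_of_mem he.2, he.1.2]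
    exact ⟨Finset.erase_subset_erase _ he.1.1, rfl⟩

theorem exists_TT' {H : Finset (Finset V)} (hH : ∀ e ∈ H, e.card = 3) {e : Finset V} (he : e ∈ H) :
    ∃ a b c, e = {a, b, c} ∧ TT H a b c := by
  have : e.Nonempty := Finset.card_pos.1 (by rw [hH e he]; norm_num)
  obtain ⟨a, ha⟩ := this
  exact ⟨a, exists_TT hH he ha⟩

theorem all_good {H : Finset (Finset V)} (hH : ∀ e ∈ H, e.card = 3) {A : Finset V}
    (hA : ∀ e ∈ H, e ⊆ A) (hm : 7 ≤ A.card) (hG : ∀ a b c, TT H a b c → GoodE H a b c) :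
    H.card ≤ (A.card - 1).choose 2 ∧ (H.card = (A.card - 1).choose 2 →
      ∃ v ∈ A, H = (A.powersetCard 3).filter (fun e => v ∈ e)) := by
  obtain ⟨M, hM⟩ : ∃ M, A.card = M + 2 := ⟨A.card - 2, by omega⟩
  have hw : ∀ e ∈ H, 1 + 2 / (M : ℚ) ≤ wt H e := by
    intro e he
    obtain ⟨a, b, c, rfl, hT⟩ := exists_TT' hH he
    have := (good_wt hH hA hm hT (hG _ _ _ hT)).1
    rwa [hM, Nat.add_sub_cancel] at this
  have hs := sum_wt hA
  have hc : ((A.card).choose 2 : ℚ) = (1 + 2 / (M : ℚ)) * (((A.card - 1).choose 2 : ℕ) : ℚ) := by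
    rw [Nat.cast_choose_two, Nat.cast_choose_two, hM]
    have : (M : ℚ) ≠ 0 := by
      have : M ≠ 0 := by omega
      exact_mod_cast this
    rw [show M + 2 - 1 = M + 1 by omega]
    push_cast
    field_simp
    ring
  have hpos : 0 < 1 + 2 / (M : ℚ) := by positivity
  have hl : (1 + 2 / (M : ℚ)) * (H.card : ℚ) ≤ ∑ e ∈ H, wt H e := by
    have := Finset.sum_le_sum hw
    rw [Finset.sum_const, nsmul_eq_mul] at this
    linarith
  refine ⟨?_, fun heq => ?_⟩
  · rw [hc] at hs
    have := le_of_mul_le_mul_left (hl.trans hs) hpos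
    exact_mod_cast this
  · have hall : ∀ e ∈ H, 1 + 2 / (M : ℚ) = wt H e := by
      rw [← Finset.sum_eq_sum_iff_of_le hw]
      apply le_antisymm (Finset.sum_le_sum hw)
      rw [Finset.sum_const, nsmul_eq_mul, heq]
      linarith
    have hne : H.Nonempty := by
      rw [← Finset.card_pos, heq]
      apply Nat.choose_pos
      omega
    obtain ⟨e, he⟩ := hne
    have main : ∀ e ∈ H, ∃ u v w, e = {u, v, w} ∧ (∀ t, TT H v w t → t = u) ∧
        codeg H {u, v} = A.card - 2 ∧ codeg H {u, w} = A.card - 2 := by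
      intro e he
      have h1 := hall e he
      obtain ⟨a, b, c, rfl, hT⟩ := exists_TT' hH he
      apply (good_wt hH hA hm hT (hG _ _ _ hT)).2
      rw [← h1, hM, Nat.add_sub_cancel]
    obtain ⟨a, b, c, rfl, h1, h2, h3⟩ := main e he
    have h0 : TT H a b c := he
    have d := h0.ne hH
    have hmA := mem_A hA h0
    have f1 := all_of_codeg hH hA h0 h2
    have f2 := all_of_codeg hH hA h0.s2 h3
    have f3 : ∀ z ∈ A, z ≠ a → ∀ y ∈ A, y ≠ a → y ≠ z → TT H a z y := by
      intro z hz hza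
      by_cases hzb : z = b
      · subst hzb; intro y hy hya hyz; exact f1 y hy hya hyz
      by_cases hzc : z = c
      · subst hzc; intro y hy hya hyz; exact f2 y hy hya hyz
      have t1 := f1 z hz hza hzb
      obtain ⟨u, v, w, e1, e2, e3, e4⟩ := main _ t1
      have t2 : TT H u v w := by unfold TT; rw [← e1]; exact t1
      have d2 := t2.ne hH
      have f4 := all_of_codeg hH hA t2 e3
      have f5 := all_of_codeg hH hA t2.s2 e4
      -- ab is not the private pair
      have np : ∀ t, t ∈ A → t ≠ b → t ≠ z → ¬ TT H b z c := by
        intro t _ _ _ hh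
        exact hza (h1 z hh.s2)
      have hbzc : ¬ TT H b z c := fun hh => hza (h1 z hh.s2)
      have e1' : ∀ t, (t = a ∨ t = b ∨ t = z) ↔ (t = u ∨ t = v ∨ t = w) := by
        intro t
        have := Finset.ext_iff.1 e1 t
        simpa using this
      have hu : u = a ∨ u = b ∨ u = z := (e1' u).2 (by simp)
      have hv : v = a ∨ v = b ∨ v = z := (e1' v).2 (by simp)
      have hw : w = a ∨ w = b ∨ w = z := (e1' w).2 (by simp)
      intro y hy hya hyz
      have g4 := f4 y hy
      have g5 := f5 y hy
      have k4 := f4 c hmA.2.2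
      have k5 := f5 c hmA.2.2
      have s4 : ∀ {p q r}, TT H p q r → TT H q p r := fun h => h.s1
      rcases hu with rfl | rfl | rfl
      · rcases hv with rfl | rfl | rfl
        · grind
        · have : w = z := by grind
          subst this
          exact g5 hya hyz
        · exact g4 hya hyz
      · exfalso
        rcases hv with rfl | rfl | rfl
        · have : w = z := by grind
          subst this
          exact hbzc (k5 (by grind) (by grind))
        · grind
        · exact hbzc (k4 (by grind) (by grind))
      · rcases hv with rfl | rfl | rfl
        · exact (g4 hyz hya).s1
        · exact (hbzc (k4 (by grind) (by grind)).s1).elim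
        · grind
    refine ⟨a, hmA.1, ?_⟩
    symm
    apply Finset.eq_of_subset_of_card_le
    · intro s hs
      simp only [Finset.mem_filter, Finset.mem_powersetCard] at hs
      obtain ⟨p, q, hpq, h⟩ := Finset.card_eq_two.1
        (show (s.erase a).card = 2 by rw [Finset.card_erase_of_mem hs.2, hs.1.2])
      have h' : s = {a, p, q} := by rw [← h, Finset.insert_erase hs.2]
      have hp : p ∈ s.erase a := by rw [h]; simp
      have hq : q ∈ s.erase a := by rw [h]; simp
      rw [Finset.mem_erase] at hp hq
      rw [h']
      exact f3 p (hs.1.1 hp.2) hp.1 q (hs.1.1 hq.2) hq.1 hpq.symm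
    · rw [star_card hmA.1, heq]


/-- indicator of an edge -/
noncomputable def ind (H : Finset (Finset V)) (a b c : V) : ℕ :=
  if ({a, b, c} : Finset V) ∈ H then 1 else 0

theorem ind_i1 (H : Finset (Finset V)) (a b c : V) : ind H a b c = ind H b a c := by
  unfold ind; rw [Finset.insert_comm]

theorem ind_i2 (H : Finset (Finset V)) (a b c : V) : ind H a b c = ind H a c b := by
  unfold ind; rw [Finset.pair_comm]

theorem ind_i3 (H : Finset (Finset V)) (a b c : V) : ind H a b c = ind H b c a := by
  rw [ind_i1, ind_i2]

theorem ind_i4 (H : Finset (Finset V)) (a b c : V) : ind H a b c = ind H c a b := by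
  rw [ind_i2, ind_i1]

theorem ind_i5 (H : Finset (Finset V)) (a b c : V) : ind H a b c = ind H c b a := by
  rw [ind_i1, ind_i4]

theorem ind_le (H : Finset (Finset V)) (a b c : V) : ind H a b c ≤ 1 := by
  unfold ind; split <;> simp

theorem ind_cases (H : Finset (Finset V)) (a b c : V) :
    (TT H a b c ∧ ind H a b c = 1) ∨ (¬ TT H a b c ∧ ind H a b c = 0) := by
  unfold ind TT; split <;> simp_all

theorem six_card {H : Finset (Finset V)} (hH : ∀ e ∈ H, e.card = 3) {a b c d e f : V}
    (nd : [a, b, c, d, e, f].Nodup) :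
    (H.filter (fun s => s ⊆ {a, b, c, d, e, f})).card ≤
      ind H a b c + ind H a b d + ind H a b e + ind H a b f + ind H a c d + ind H a c e +
      ind H a c f + ind H a d e + ind H a d f + ind H a e f + ind H b c d + ind H b c e +
      ind H b c f + ind H b d e + ind H b d f + ind H b e f + ind H c d e + ind H c d f +
      ind H c e f + ind H d e f := by
  let φ : Fin 6 ↪ V := ⟨fun i => [a, b, c, d, e, f].get i, List.nodup_iff_injective_get.1 nd⟩
  have hU : ({a, b, c, d, e, f} : Finset V) = Finset.univ.map φ := by
    ext t
    simp [φ, Fin.exists_fin_succ]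
    tauto
  have hsub : H.filter (fun s => s ⊆ {a, b, c, d, e, f}) ⊆
      (Finset.powersetCard 3 (Finset.univ.map φ)).filter (fun s => s ∈ H) := by
    intro s hs
    rw [Finset.mem_filter, hU] at hs
    rw [Finset.mem_filter, Finset.mem_powersetCard]
    exact ⟨⟨hs.2, hH s hs.1⟩, hs.1⟩
  refine (Finset.card_le_card hsub).trans ?_
  rw [Finset.card_filter, Finset.powersetCard_map, Finset.sum_map]
  have : Finset.powersetCard 3 (Finset.univ : Finset (Fin 6)) = {{0, 1, 2}, {0, 1, 3}, {0, 1, 4},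
    {0, 1, 5}, {0, 2, 3}, {0, 2, 4}, {0, 2, 5}, {0, 3, 4}, {0, 3, 5}, {0, 4, 5}, {1, 2, 3},
    {1, 2, 4}, {1, 2, 5}, {1, 3, 4}, {1, 3, 5}, {1, 4, 5}, {2, 3, 4}, {2, 3, 5}, {2, 4, 5},
    {3, 4, 5}} := by decide
  rw [this]
  repeat rw [Finset.sum_insert (by decide)]
  rw [Finset.sum_singleton]
  simp only [RelEmbedding.coe_toEmbedding, Finset.mapEmbedding_apply, Finset.map_insert,
    Finset.map_singleton]
  apply le_of_eq
  simp only [← add_assoc]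
  rfl

theorem pasch {H : Finset (Finset V)} (hC : ¬ HasC33 H) (x y z u v w : V)
    (nd : [x, y, z, u, v, w].Nodup) :
    ind H x y z + ind H z u v + ind H v w x + ind H y u w ≤ 2 := by
  have nd' := nd
  simp only [List.nodup_cons, List.mem_cons, List.not_mem_nil] at nd'
  have c1 := ind_cases H x y z
  have c2 := ind_cases H z u v
  have c3 := ind_cases H v w x
  have c4 := ind_cases H y u w
  by_contra hcon
  by_cases h1 : TT H x y z
  · by_cases h2 : TT H z u v
    · by_cases h3 : TT H v w x
      · exact noC hC x y z u v w h1 h2 h3 nd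
      · have h4 : TT H y u w := by
          by_contra h4
          simp only [h1, h2, h3, h4] at *
          grind
        exact noC hC z x y w u v h1.s4 h4.s2 h2.s3 (by simp; grind)
    · have h3 : TT H v w x := by
        by_contra h3
        grind
      have h4 : TT H y u w := by
        by_contra h4
        grind
      exact noC hC x z y u w v h1.s2 h4 h3.s1 (by simp; grind)
  · have h2 : TT H z u v := by
      by_contra h
      grind
    have h3 : TT H v w x := by
      by_contra h
      grind
    have h4 : TT H y u w := by
      by_contra h
      grind
    exact noC hC v z u y w x h2.s4 h4.s1 h3.s3 (by simp; grind)

theorem card_six {H : Finset (Finset V)} (hH : ∀ e ∈ H, e.card = 3) (hC : ¬ HasC33 H)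
    {A : Finset V} (hA : ∀ e ∈ H, e ⊆ A) (hm : A.card = 6) : H.card ≤ 10 := by
  obtain ⟨a, b, c, d, e, f, nd, rfl⟩ : ∃ a b c d e f, [a, b, c, d, e, f].Nodup ∧
      A = {a, b, c, d, e, f} := by
    have hl : A.toList.length = 6 := by simp [hm]
    have hnd := A.nodup_toList
    have hA' : A = A.toList.toFinset := by simp
    generalize A.toList = l at *
    match l, hl with
    | [a, b, c, d, e, f], _ => exact ⟨a, b, c, d, e, f, hnd, by rw [hA']; simp⟩
  have h6 := six_card hH nd
  rw [Finset.filter_true_of_mem hA] at h6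
  have := pasch hC c a b d f e (by simp only [List.nodup_cons, List.mem_cons, List.not_mem_nil] at nd ⊢; grind)
  have := pasch hC b a c d f e (by simp only [List.nodup_cons, List.mem_cons, List.not_mem_nil] at nd ⊢; grind)
  have := pasch hC a b d e f c (by simp only [List.nodup_cons, List.mem_cons, List.not_mem_nil] at nd ⊢; grind)
  have := pasch hC a b d e c f (by simp only [List.nodup_cons, List.mem_cons, List.not_mem_nil] at nd ⊢; grind)
  have := pasch hC a b e c f d (by simp only [List.nodup_cons, List.mem_cons, List.not_mem_nil] at nd ⊢; grind)
  have := pasch hC a b e c d f (by simp only [List.nodup_cons, List.mem_cons, List.not_mem_nil] at nd ⊢; grind)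
  have := pasch hC f a b c d e (by simp only [List.nodup_cons, List.mem_cons, List.not_mem_nil] at nd ⊢; grind)
  have := pasch hC a b f d c e (by simp only [List.nodup_cons, List.mem_cons, List.not_mem_nil] at nd ⊢; grind)
  have := pasch hC f a e c b d (by simp only [List.nodup_cons, List.mem_cons, List.not_mem_nil] at nd ⊢; grind)
  have := pasch hC e a f c b d (by simp only [List.nodup_cons, List.mem_cons, List.not_mem_nil] at nd ⊢; grind)
  have := ind_i1 H b a c
  have := ind_i1 H e a f
  have := ind_i1 H e c f
  have := ind_i2 H b e c
  have := ind_i3 H c a b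
  have := ind_i3 H e c d
  have := ind_i3 H f a b
  have := ind_i3 H f a e
  have := ind_i4 H c e a
  have := ind_i4 H c f a
  have := ind_i4 H d e c
  have := ind_i4 H d f a
  have := ind_i5 H e c b
  have := ind_i5 H f c a
  have := ind_i5 H f c b
  have := ind_i5 H f d a
  have := ind_i5 H f d c
  have := ind_i5 H f e b
  have := ind_i5 H f e c
  omega


theorem noP_mono {H K : Finset (Finset V)} (h : K ⊆ H) (hP : ¬ HasP33 H) : ¬ HasP33 K := by
  rintro ⟨e₁, e₂, e₃, h1, h2, h3, h4⟩
  exact hP ⟨e₁, e₂, e₃, h h1, h h2, h h3, h4⟩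

theorem noC_mono {H K : Finset (Finset V)} (h : K ⊆ H) (hC : ¬ HasC33 H) : ¬ HasC33 K := by
  rintro ⟨a, b, c, d, e, f, h0, h1, h2, h3⟩
  exact hC ⟨a, b, c, d, e, f, h0, h h1, h h2, h h3⟩

theorem choose_step (k : ℕ) : (k + 1).choose 2 = k + k.choose 2 := by
  rw [Nat.choose_succ_succ' k 1, Nat.choose_one_right]

theorem card_le_choose {H : Finset (Finset V)} (hH : ∀ e ∈ H, e.card = 3) {A : Finset V}
    (hA : ∀ e ∈ H, e ⊆ A) : H.card ≤ A.card.choose 3 := by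
  rw [← Finset.card_powersetCard]
  apply Finset.card_le_card
  intro e he
  exact Finset.mem_powersetCard.2 ⟨hA e he, hH e he⟩

theorem PC_free (m : ℕ) (hm : 6 ≤ m) : ∀ (A : Finset V) (H : Finset (Finset V)), A.card = m →
    (∀ e ∈ H, e.card = 3) → (∀ e ∈ H, e ⊆ A) → ¬ HasP33 H → ¬ HasC33 H →
    H.card ≤ (m - 1).choose 2 ∧ (8 ≤ m → H.card = (m - 1).choose 2 →
      ∃ v ∈ A, H = (A.powersetCard 3).filter (fun e => v ∈ e)) := by
  induction m, hm using Nat.le_induction with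
  | base =>
    intro A H hAm hH hA hP hC
    exact ⟨card_six hH hC hA hAm, fun h => absurd h (by norm_num)⟩
  | succ m hm ih =>
    intro A H hAm hH hA hP hC
    by_cases hG : ∀ a b c, TT H a b c → GoodE H a b c
    · have := all_good hH hA (by omega) hG
      rw [hAm] at this
      exact ⟨this.1, fun _ => this.2⟩
    push Not at hG
    obtain ⟨a, b, c, hT, hG⟩ := hG
    have hlow := bad_main hH hP hC hT hG
    obtain ⟨k, rfl⟩ : ∃ k, m = k + 1 := ⟨m - 1, by omega⟩
    simp only [Nat.add_sub_cancel] at *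
    have del : ∀ v, (∃ e ∈ H, v ∈ e) →
        H.card ≤ (H.filter (fun e => v ∈ e)).card + k.choose 2 := by
      rintro v ⟨e, he, hve⟩
      rw [← Finset.card_filter_add_card_filter_not (s := H) (fun e => v ∈ e)]
      have hvA := hA e he hve
      have := (ih (A.erase v) (H.filter (fun e => ¬ v ∈ e))
        (by rw [Finset.card_erase_of_mem hvA, hAm]; rfl)
        (fun e he => hH e (Finset.mem_filter.1 he).1)
        (fun e he => Finset.subset_erase.2 ⟨hA e (Finset.mem_filter.1 he).1,
          (Finset.mem_filter.1 he).2⟩)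
        (noP_mono (Finset.filter_subset _ _) hP) (noC_mono (Finset.filter_subset _ _) hC)).1
      omega
    have hstep := choose_step k
    rcases hlow with ⟨v, hv, hd⟩ | ⟨a, b, c, hT, hd, h10⟩
    · have := del v hv
      exact ⟨by omega, fun h8 heq => by omega⟩
    · have hda := del a ⟨_, hT, by simp⟩
      by_cases h8 : 7 ≤ k
      · exact ⟨by omega, fun h8 heq => by omega⟩
      · have hrest := card_le_choose (H := H.filter (fun e => ¬ ¬ Disjoint e {a, b, c}))
          (A := A \ {a, b, c}) (fun e he => hH e (Finset.mem_filter.1 he).1)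
          (fun e he => Finset.subset_sdiff.2 ⟨hA e (Finset.mem_filter.1 he).1,
            not_not.1 (Finset.mem_filter.1 he).2⟩)
        rw [Finset.card_sdiff_of_subset (hA _ hT), hH _ hT, hAm] at hrest
        have hsplit := Finset.card_filter_add_card_filter_not (s := H)
          (fun e => ¬ Disjoint e {a, b, c})
        have : k = 5 ∨ k = 6 := by omega
        rcases this with rfl | rfl
        · simp only [show (5 + 1 + 1 - 3).choose 3 = 4 by decide] at hrest
          simp only [show (5 + 1).choose 2 = 15 by decide]
          exact ⟨by omega, fun h8 heq => by omega⟩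
        · simp only [show (6 + 1 + 1 - 3).choose 3 = 10 by decide] at hrest
          simp only [show (6 + 1).choose 2 = 21 by decide]
          exact ⟨by omega, fun h8 heq => by omega⟩


/-- A copy of the triangle, with corners `a`, `c`, `e`. -/
structure Tri (H : Finset (Finset V)) (a b c d e f : V) : Prop where
  nd : [a, b, c, d, e, f].Nodup
  h1 : TT H a b c
  h2 : TT H c d e
  h3 : TT H e f a

theorem Tri.rot {H : Finset (Finset V)} {a b c d e f : V} (h : Tri H a b c d e f) :
    Tri H c d e f a b :=
  ⟨by have := h.nd; simp only [List.nodup_cons, List.mem_cons, List.not_mem_nil] at this ⊢; grind,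
    h.h2, h.h3, h.h1⟩

theorem rot_set (a b c d e f : V) :
    ({c, d, e, f, a, b} : Finset V) = {a, b, c, d, e, f} := by
  ext t; simp; tauto

theorem Tri.X1 {H : Finset (Finset V)} (hH : ∀ e ∈ H, e.card = 3) (hP : ¬ HasP33 H)
    {a b c d e f : V} (h : Tri H a b c d e f) {y v : V}
    (hy : y ∉ ({a, b, c, d, e, f} : Finset V)) (hT : TT H y a v) : v = c ∨ v = d ∨ v = e := by
  have nd := h.nd
  have dd := hT.ne hH
  simp only [List.nodup_cons, List.mem_cons, List.not_mem_nil] at nd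
  simp only [Finset.mem_insert, Finset.mem_singleton, not_or] at hy
  by_contra hcon
  by_cases hb : v = b
  · subst hb
    exact noP hP y v a f e d c hT.s2 h.h3.s5 h.h2.s5 (by simp; grind)
  · exact noP hP y v a b c d e hT.s2 h.h1 h.h2 (by simp; grind)

theorem Tri.X2 {H : Finset (Finset V)} (hH : ∀ e ∈ H, e.card = 3) (hP : ¬ HasP33 H)
    {a b c d e f : V} (h : Tri H a b c d e f) {y v : V}
    (hy : y ∉ ({a, b, c, d, e, f} : Finset V)) (hT : TT H y b v) : v = e := by
  have nd := h.nd
  have dd := hT.ne hH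
  simp only [List.nodup_cons, List.mem_cons, List.not_mem_nil] at nd
  simp only [Finset.mem_insert, Finset.mem_singleton, not_or] at hy
  by_contra hcon
  by_cases ha : v = a
  · subst ha
    exact noP hP y b v f e d c hT h.h3.s5 h.h2.s5 (by simp; grind)
  by_cases hc : v = c
  · subst hc
    exact noP hP y b v d e f a hT h.h2 h.h3 (by simp; grind)
  by_cases hd : v = d
  · subst hd
    exact noP hP y v b c a f e hT.s2 h.h1.s3 h.h3.s5 (by simp; grind)
  · exact noP hP y v b a c d e hT.s2 h.h1.s1 h.h2 (by simp; grind)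

theorem Tri.classify {H : Finset (Finset V)} (hH : ∀ e ∈ H, e.card = 3) (hP : ¬ HasP33 H)
    {a b c d e f : V} (h : Tri H a b c d e f) {y u v : V}
    (hy : y ∉ ({a, b, c, d, e, f} : Finset V)) (hu : u ∈ ({a, b, c, d, e, f} : Finset V))
    (hT : TT H y u v) :
    (({y, u, v} : Finset V) = {y, a, c} ∨ ({y, u, v} : Finset V) = {y, c, e} ∨
    ({y, u, v} : Finset V) = {y, e, a} ∨ ({y, u, v} : Finset V) = {y, a, d} ∨
    ({y, u, v} : Finset V) = {y, c, f} ∨ ({y, u, v} : Finset V) = {y, e, b}) := by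
  have hr := h.rot
  have hrr := hr.rot
  have hy' := hy
  have hy'' := hy
  rw [← rot_set] at hy'
  rw [← rot_set, ← rot_set] at hy''
  simp only [Finset.mem_insert, Finset.mem_singleton] at hu
  rcases hu with rfl | rfl | rfl | rfl | rfl | rfl
  · rcases h.X1 hH hP hy hT with rfl | rfl | rfl <;> simp [Finset.pair_comm]
  · rcases h.X2 hH hP hy hT with rfl <;> simp [Finset.pair_comm]
  · rcases hr.X1 hH hP hy' hT with rfl | rfl | rfl <;> simp [Finset.pair_comm]
  · rcases hr.X2 hH hP hy' hT with rfl <;> simp [Finset.pair_comm]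
  · rcases hrr.X1 hH hP hy'' hT with rfl | rfl | rfl <;> simp [Finset.pair_comm]
  · rcases hrr.X2 hH hP hy'' hT with rfl <;> simp [Finset.pair_comm]

/-- up to rotation, every cross edge is of one of two types -/
theorem Tri.classify' {H : Finset (Finset V)} (hH : ∀ e ∈ H, e.card = 3) (hP : ¬ HasP33 H)
    {a b c d e f : V} (h : Tri H a b c d e f) {y u v : V}
    (hy : y ∉ ({a, b, c, d, e, f} : Finset V)) (hu : u ∈ ({a, b, c, d, e, f} : Finset V))
    (hT : TT H y u v) :
    ∃ a' b' c' d' e' f', Tri H a' b' c' d' e' f' ∧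
      ({a', b', c', d', e', f'} : Finset V) = {a, b, c, d, e, f} ∧
      (TT H y a' c' ∨ TT H y a' d') := by
  have hr := h.rot
  have hrr := hr.rot
  have e1 := rot_set a b c d e f
  have e2 : ({e, f, a, b, c, d} : Finset V) = {a, b, c, d, e, f} := by rw [rot_set, rot_set]
  unfold TT at hT
  rcases h.classify hH hP hy hu hT with h' | h' | h' | h' | h' | h' <;> rw [h'] at hT
  · exact ⟨_, _, _, _, _, _, h, rfl, Or.inl hT⟩
  · exact ⟨_, _, _, _, _, _, hr, e1, Or.inl hT⟩
  · exact ⟨_, _, _, _, _, _, hrr, e2, Or.inl hT⟩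
  · exact ⟨_, _, _, _, _, _, h, rfl, Or.inr hT⟩
  · exact ⟨_, _, _, _, _, _, hr, e1, Or.inr hT⟩
  · exact ⟨_, _, _, _, _, _, hrr, e2, Or.inr hT⟩

theorem Tri.F3 {H : Finset (Finset V)} (hH : ∀ e ∈ H, e.card = 3) (hP : ¬ HasP33 H)
    {a b c d e f : V} (h : Tri H a b c d e f) {y u v p q : V}
    (hy : y ∉ ({a, b, c, d, e, f} : Finset V)) (hu : u ∈ ({a, b, c, d, e, f} : Finset V))
    (hT : TT H y u v) (hp : p ∉ ({a, b, c, d, e, f} : Finset V))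
    (hq : q ∉ ({a, b, c, d, e, f} : Finset V)) (hT' : TT H y p q) : False := by
  obtain ⟨a', b', c', d', e', f', h2, he, hor⟩ := h.classify' hH hP hy hu hT
  rw [← he] at hy hp hq
  clear h hT he hu
  have nd := h2.nd
  have dd := hT'.ne hH
  simp only [List.nodup_cons, List.mem_cons, List.not_mem_nil] at nd
  simp only [Finset.mem_insert, Finset.mem_singleton, not_or] at hy hp hq
  rcases hor with hor | hor
  · exact noP hP p q y a' c' d' e' hT'.s3 hor h2.h2 (by simp; grind)
  · exact noP hP p q y d' a' b' c' hT'.s3 hor.s2 h2.h1 (by simp; grind)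

theorem Tri.F4 {H : Finset (Finset V)} (hP : ¬ HasP33 H)
    {a b c d e f : V} (h : Tri H a b c d e f) {y z : V}
    (hy : y ∉ ({a, b, c, d, e, f} : Finset V)) (hz : z ∉ ({a, b, c, d, e, f} : Finset V))
    (hT : TT H y a c) (hT' : TT H z e b) : y = z := by
  have nd := h.nd
  simp only [List.nodup_cons, List.mem_cons, List.not_mem_nil] at nd
  simp only [Finset.mem_insert, Finset.mem_singleton, not_or] at hy hz
  by_contra hne
  exact noP hP y a c d e b z hT h.h2 hT'.s3 (by simp; grind)

theorem ind_zero {H : Finset (Finset V)} {a b c : V} (h : TT H a b c → False) :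
    ind H a b c = 0 := by
  rcases ind_cases H a b c with h' | h'
  · exact (h h'.1).elim
  · exact h'.2

theorem ind_pair {H : Finset (Finset V)} {a b c d e f : V}
    (h : TT H a b c → TT H d e f → False) : ind H a b c + ind H d e f ≤ 1 := by
  rcases ind_cases H a b c with h1 | h1
  · have := ind_zero (h h1.1)
    omega
  · have := ind_le H d e f
    omega

theorem Tri.inside {H : Finset (Finset V)} (hH : ∀ e ∈ H, e.card = 3) (hP : ¬ HasP33 H)
    {a b c d e f : V} (h : Tri H a b c d e f) {y : V}
    (hy : y ∉ ({a, b, c, d, e, f} : Finset V)) (hor : TT H y a c ∨ TT H y a d) :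
    (H.filter (fun s => s ⊆ {a, b, c, d, e, f})).card ≤ 11 := by
  have h6 := six_card hH h.nd
  have nd := h.nd
  simp only [List.nodup_cons, List.mem_cons, List.not_mem_nil] at nd
  simp only [Finset.mem_insert, Finset.mem_singleton, not_or] at hy
  have l1 := ind_le H a b c
  have l2 := ind_le H a c d
  have l3 := ind_le H a c e
  have l4 := ind_le H a c f
  have l5 := ind_le H d e f
  have l6 := ind_le H a b d
  have l7 := ind_le H a d e
  have l8 := ind_le H a d f
  rcases hor with hT | hT
  · have z1 : ind H b d f = 0 := ind_zero fun hz =>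
      noP hP y a c e d b f hT h.h2.s2 hz.s1 (by simp; grind)
    have z2 : ind H b e f = 0 := ind_zero fun hz =>
      noP hP y a c d e b f hT h.h2 hz.s1 (by simp; grind)
    have z3 : ind H b d e = 0 := ind_zero fun hz =>
      noP hP y c a f e b d hT.s2 h.h3.s5 hz.s4 (by simp; grind)
    have gen : ∀ p q r s, [p, q, a, y, c, r, s].Nodup → TT H a p q → TT H c r s → False :=
      fun p q r s hn g1 g2 => noP hP p q a y c r s g1.s3 hT.s1 g2 hn
    have q1 : ind H a b d + ind H c e f ≤ 1 := ind_pair (gen _ _ _ _ (by simp; grind))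
    have q2 : ind H a b e + ind H c d f ≤ 1 := ind_pair (gen _ _ _ _ (by simp; grind))
    have q3 : ind H a b f + ind H c d e ≤ 1 := ind_pair (gen _ _ _ _ (by simp; grind))
    have q4 : ind H a d e + ind H c b f ≤ 1 := ind_pair (gen _ _ _ _ (by simp; grind))
    have q5 : ind H a d f + ind H c b e ≤ 1 := ind_pair (gen _ _ _ _ (by simp; grind))
    have q6 : ind H a e f + ind H c b d ≤ 1 := ind_pair (gen _ _ _ _ (by simp; grind))
    rw [ind_i1 H c b] at q4 q5 q6
    omega
  · have z1 : ind H b e f = 0 := ind_zero fun hz =>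
      noP hP y d a c b e f hT.s2 h.h1.s2 hz (by simp; grind)
    have z2 : ind H c e f = 0 := ind_zero fun hz =>
      noP hP y d a b c e f hT.s2 h.h1 hz (by simp; grind)
    have z3 : ind H b c e = 0 := ind_zero fun hz =>
      noP hP y d a f e b c hT.s2 h.h3.s5 hz.s4 (by simp; grind)
    have z4 : ind H b c f = 0 := ind_zero fun hz =>
      noP hP y d a e f b c hT.s2 h.h3.s4 hz.s4 (by simp; grind)
    have gen : ∀ p q r s, [p, q, a, y, d, r, s].Nodup → TT H a p q → TT H d r s → False :=
      fun p q r s hn g1 g2 => noP hP p q a y d r s g1.s3 hT.s1 g2 hn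
    have q1 : ind H a b c + ind H d e f ≤ 1 := ind_pair (gen _ _ _ _ (by simp; grind))
    have q2 : ind H a b e + ind H d c f ≤ 1 := ind_pair (gen _ _ _ _ (by simp; grind))
    have q3 : ind H a b f + ind H d c e ≤ 1 := ind_pair (gen _ _ _ _ (by simp; grind))
    have q4 : ind H a c e + ind H d b f ≤ 1 := ind_pair (gen _ _ _ _ (by simp; grind))
    have q5 : ind H a c f + ind H d b e ≤ 1 := ind_pair (gen _ _ _ _ (by simp; grind))
    have q6 : ind H a e f + ind H d b c ≤ 1 := ind_pair (gen _ _ _ _ (by simp; grind))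
    rw [ind_i1 H d] at q2 q3 q4 q5
    rw [ind_i3 H d] at q6
    omega

theorem card_pair_le {Y Y1 Y2 : Finset V} (h1 : Y1 ⊆ Y) (h2 : Y2 ⊆ Y)
    (h : ∀ y ∈ Y1, ∀ z ∈ Y2, y = z) : Y1.card + Y2.card ≤ Y.card + 1 := by
  have c1 := Finset.card_le_card h1
  have c2 := Finset.card_le_card h2
  rcases Y1.eq_empty_or_nonempty with rfl | ⟨y, hy⟩
  · simp; omega
  · have : Y2 ⊆ {y} := fun z hz => by rw [Finset.mem_singleton, h y hy z hz]
    have := Finset.card_le_card this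
    rw [Finset.card_singleton] at this
    omega

theorem Tri.struct {H : Finset (Finset V)} (hH : ∀ e ∈ H, e.card = 3) (hP : ¬ HasP33 H)
    {A : Finset V} (hA : ∀ e ∈ H, e ⊆ A) {a b c d e f : V} (h : Tri H a b c d e f) :
    ∃ U ⊆ A, U.card = 6 ∧ ((∀ e ∈ H, e ⊆ U ∨ e ⊆ A \ U) ∨
      ∃ k, 1 ≤ k ∧ k ≤ A.card - 6 ∧ ∃ B, B.card = A.card - 6 - k ∧
        H.card ≤ 14 + 3 * k + (H.filter (fun e => e ⊆ B)).card) := by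
  classical
  obtain ⟨U, hU⟩ : ∃ U : Finset V, U = {a, b, c, d, e, f} := ⟨_, rfl⟩
  have m1 := mem_A hA h.h1
  have m2 := mem_A hA h.h2
  have m3 := mem_A hA h.h3
  have hUA : U ⊆ A := by rw [hU]; simp [Finset.insert_subset_iff, m1, m2, m3]
  have hUc : U.card = 6 := by
    have := List.toFinset_card_of_nodup h.nd
    rw [hU]
    simpa using this
  refine ⟨U, hUA, hUc, ?_⟩
  let Y := A.filter (fun y => y ∉ U ∧ ∃ u v, u ∈ U ∧ TT H y u v)
  have hYU : ∀ y ∈ Y, y ∉ U := fun y hy => (Finset.mem_filter.1 hy).2.1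
  have cover : ∀ s ∈ H, s ⊆ U ∨ s ⊆ (A \ U) \ Y ∨ ∃ y ∈ Y, ∃ u v, u ∈ U ∧ TT H y u v ∧
      s = {y, u, v} := by
    intro s hs
    by_cases hsU : s ⊆ U
    · exact Or.inl hsU
    right
    by_cases hd : ∃ u ∈ s, u ∈ U
    · right
      obtain ⟨u, hus, huU⟩ := hd
      obtain ⟨y, hys, hyU⟩ := Finset.not_subset.1 hsU
      obtain ⟨v, hv, hT⟩ := TT_of_pair hH hs (show y ≠ u by rintro rfl; exact hyU huU) hys hus
      exact ⟨y, Finset.mem_filter.2 ⟨hA s hs hys, hyU, u, v, huU, hT⟩, u, v, huU, hT, hv⟩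
    · left
      push Not at hd
      intro y hys
      rw [Finset.mem_sdiff, Finset.mem_sdiff]
      refine ⟨⟨hA s hs hys, hd y hys⟩, fun hyY => ?_⟩
      obtain ⟨_, hyU, u, v, huU, hT⟩ := Finset.mem_filter.1 hyY
      obtain ⟨p, q, hpq, hT'⟩ := exists_TT hH hs hys
      have hp := hd p (by rw [hpq]; simp)
      have hq := hd q (by rw [hpq]; simp)
      rw [hU] at hyU huU hp hq
      exact h.F3 hH hP hyU huU hT hp hq hT'
  rcases Y.eq_empty_or_nonempty with hYe | ⟨y0, hy0⟩
  · left
    intro s hs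
    rcases cover s hs with h' | h' | ⟨y, hy, _⟩
    · exact Or.inl h'
    · exact Or.inr (h'.trans Finset.sdiff_subset)
    · rw [hYe] at hy; simp at hy
  right
  have hYsub : Y ⊆ A \ U := fun y hy =>
    Finset.mem_sdiff.2 ⟨(Finset.mem_filter.1 hy).1, hYU y hy⟩
  have hAU : (A \ U).card = A.card - 6 := by rw [Finset.card_sdiff_of_subset hUA, hUc]
  refine ⟨Y.card, Finset.card_pos.2 ⟨y0, hy0⟩, hAU ▸ Finset.card_le_card hYsub, (A \ U) \ Y, ?_, ?_⟩
  · rw [Finset.card_sdiff_of_subset hYsub, hAU]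
  have hin : (H.filter (fun s => s ⊆ U)).card ≤ 11 := by
    obtain ⟨_, hyU, u, v, huU, hT⟩ := Finset.mem_filter.1 hy0
    rw [hU] at hyU huU
    obtain ⟨a', b', c', d', e', f', h2, he, hor⟩ := h.classify' hH hP hyU huU hT
    rw [hU, ← he]
    exact h2.inside hH hP (he ▸ hyU) hor
  let Q : V → V → Finset V := fun p q => Y.filter (fun y => TT H y p q)
  let I : V → V → Finset (Finset V) := fun p q => (Q p q).image (fun y => {y, p, q})
  have hI : ∀ p q, (I p q).card ≤ (Q p q).card := fun p q => Finset.card_image_le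
  have hQ : ∀ p q, Q p q ⊆ Y := fun p q => Finset.filter_subset _ _
  have hsub : H ⊆ H.filter (fun s => s ⊆ U) ∪ (H.filter (fun s => s ⊆ (A \ U) \ Y) ∪
      ((I a c ∪ I e b) ∪ ((I c e ∪ I a d) ∪ (I e a ∪ I c f)))) := by
    intro s hs
    simp only [Finset.mem_union, Finset.mem_filter]
    rcases cover s hs with h' | h' | ⟨y, hy, u, v, huU, hT, hsv⟩
    · exact Or.inl ⟨hs, h'⟩
    · exact Or.inr (Or.inl ⟨hs, h'⟩)
    · right; right
      have hyU := hYU y hy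
      rw [hU] at huU hyU
      have mI : ∀ p q, ({y, u, v} : Finset V) = {y, p, q} → s ∈ I p q := by
        intro p q hpq
        refine Finset.mem_image.2 ⟨y, Finset.mem_filter.2 ⟨hy, ?_⟩, ?_⟩
        · unfold TT; rw [← hpq]; exact hT
        · rw [← hpq, hsv]
      rcases h.classify hH hP hyU huU hT with h' | h' | h' | h' | h' | h' <;>
        have := mI _ _ h' <;> simp only [this, true_or, or_true]
  have q1 : (Q a c).card + (Q e b).card ≤ Y.card + 1 := by
    apply card_pair_le (hQ _ _) (hQ _ _)
    intro y hy z hz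
    have hy := Finset.mem_filter.1 hy
    have hz := Finset.mem_filter.1 hz
    exact h.F4 hP (hU ▸ hYU y hy.1) (hU ▸ hYU z hz.1) hy.2 hz.2
  have q2 : (Q c e).card + (Q a d).card ≤ Y.card + 1 := by
    apply card_pair_le (hQ _ _) (hQ _ _)
    intro y hy z hz
    have hy := Finset.mem_filter.1 hy
    have hz := Finset.mem_filter.1 hz
    refine h.rot.F4 hP ?_ ?_ hy.2 hz.2
    · rw [rot_set, ← hU]; exact hYU y hy.1
    · rw [rot_set, ← hU]; exact hYU z hz.1
  have q3 : (Q e a).card + (Q c f).card ≤ Y.card + 1 := by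
    apply card_pair_le (hQ _ _) (hQ _ _)
    intro y hy z hz
    have hy := Finset.mem_filter.1 hy
    have hz := Finset.mem_filter.1 hz
    refine h.rot.rot.F4 hP ?_ ?_ hy.2 hz.2
    · rw [rot_set, rot_set, ← hU]; exact hYU y hy.1
    · rw [rot_set, rot_set, ← hU]; exact hYU z hz.1
  have t0 := Finset.card_le_card hsub
  have t1 := t0.trans (Finset.card_union_le _ _)
  have t2 := Finset.card_union_le (H.filter (fun s => s ⊆ (A \ U) \ Y))
    ((I a c ∪ I e b) ∪ ((I c e ∪ I a d) ∪ (I e a ∪ I c f)))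
  have t3 := Finset.card_union_le (I a c ∪ I e b) ((I c e ∪ I a d) ∪ (I e a ∪ I c f))
  have t4 := Finset.card_union_le (I c e ∪ I a d) (I e a ∪ I c f)
  have t5 := Finset.card_union_le (I a c) (I e b)
  have t6 := Finset.card_union_le (I c e) (I a d)
  have t7 := Finset.card_union_le (I e a) (I c f)
  have i1 := hI a c
  have i2 := hI e b
  have i3 := hI c e
  have i4 := hI a d
  have i5 := hI e a
  have i6 := hI c f
  omega


theorem HasC33.tri {H : Finset (Finset V)} (h : HasC33 H) :
    ∃ a b c d e f : V, Tri H a b c d e f := by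
  obtain ⟨a, b, c, d, e, f, h6, h1, h2, h3⟩ := h
  refine ⟨a, b, c, d, e, f, ?_, h1, h2, h3⟩
  have hc : ([a, b, c, d, e, f] : List V).toFinset.card = [a, b, c, d, e, f].length := by
    simpa using h6
  rw [List.card_toFinset] at hc
  have := (List.dedup_sublist [a, b, c, d, e, f]).eq_of_length hc
  rw [← this]
  exact List.nodup_dedup _

/-- The Turán number of the path. -/
def F33 (m : ℕ) : ℕ := if m ≤ 6 then m.choose 3 else if m = 7 then 20 else (m - 1).choose 2

theorem two_choose (n : ℕ) : 2 * n.choose 2 + n = n * n := by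
  induction n with
  | zero => rfl
  | succ k ih => rw [choose_step]; nlinarith

theorem F33_cases (j : ℕ) : (j ≤ 7 ∧ F33 j ≤ 20 ∧ (j ≤ 5 → F33 j ≤ 10) ∧ (j ≤ 4 → F33 j ≤ 4) ∧
    (j ≤ 3 → F33 j ≤ 1) ∧ (j ≤ 2 → F33 j = 0)) ∨
    (8 ≤ j ∧ F33 j = (j - 1).choose 2) := by
  by_cases h : j ≤ 7
  · left
    interval_cases j <;> decide
  · right
    refine ⟨by omega, ?_⟩
    rw [F33, if_neg (by omega), if_neg (by omega)]

theorem num1 (m : ℕ) (hm : 8 ≤ m) : 20 + F33 (m - 6) < (m - 1).choose 2 := by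
  obtain ⟨t, rfl⟩ := Nat.exists_eq_add_of_le hm
  have h1 := two_choose (8 + t - 1)
  have e1 : 8 + t - 1 = t + 7 := by omega
  have e2 : 8 + t - 6 = t + 2 := by omega
  rw [e1] at h1 ⊢
  rw [e2]
  rcases F33_cases (t + 2) with h | ⟨h, h'⟩
  · have : t = 0 ∨ 1 ≤ t := by omega
    rcases this with rfl | h3
    · have := h.2.2.2.2.2 (by omega)
      omega
    · by_cases h2 : t = 1
      · subst h2
        have := h.2.2.2.2.1 (by omega)
        omega
      · have : 2 ≤ t := by omega
        by_cases h4 : t ≤ 3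
        · have := h.2.2.1 (by omega)
          nlinarith
        · nlinarith [h.2.1]
  · rw [h']
    have e3 : t + 2 - 1 = t + 1 := by omega
    rw [e3]
    have h2 := two_choose (t + 1)
    nlinarith

theorem num3 (m k : ℕ) (hm : 14 ≤ m) (hk : 1 ≤ k) (hk' : k ≤ m - 6) :
    14 + 3 * k + F33 (m - 6 - k) < 20 + (m - 7).choose 2 := by
  obtain ⟨j, hj⟩ : ∃ j, m - 6 - k = j := ⟨_, rfl⟩
  rw [hj]
  have hmm : m - 7 = j + k - 1 := by omega
  rw [hmm]
  have hjk : 8 ≤ j + k := by omega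
  obtain ⟨s, hs⟩ := Nat.exists_eq_add_of_le hk
  have e : j + k - 1 = j + s := by omega
  rw [e]
  subst hs
  have h1 := two_choose (j + s)
  rcases F33_cases j with h | ⟨h, h'⟩
  · obtain ⟨h7, ha, hb, hc, hd, he⟩ := h
    by_cases h5 : j ≤ 5
    · have hF : F33 j ≤ 10 := hb h5
      by_cases h4 : j ≤ 4
      · have hF : F33 j ≤ 4 := hc h4
        by_cases h3 : j ≤ 3
        · have hF := hd h3
          interval_cases j <;> nlinarith
        · have : j = 4 := by omega
          subst this
          nlinarith
      · have : j = 5 := by omega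
        subst this
        nlinarith
    · have : 6 ≤ j := by omega
      interval_cases j
      · nlinarith
      · rcases Nat.eq_zero_or_pos s with rfl | h0
        · omega
        · nlinarith
  · rw [h']
    obtain ⟨i, rfl⟩ := Nat.exists_eq_add_of_le h
    have e3 : 8 + i - 1 = i + 7 := by omega
    rw [e3]
    have h2 := two_choose (i + 7)
    nlinarith

theorem num2 (m k : ℕ) (hm : 8 ≤ m) (hk : 1 ≤ k) (hk' : k ≤ m - 6) :
    14 + 3 * k + F33 (m - 6 - k) < (m - 1).choose 2 := by
  by_cases h14 : 14 ≤ m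
  · have h3 := num3 m k h14 hk hk'
    have h1 := num1 m (by omega)
    have : F33 (m - 6) = (m - 7).choose 2 := by
      rw [F33, if_neg (by omega), if_neg (by omega)]; congr 1
    omega
  · have : m ≤ 13 := by omega
    have : k ≤ 7 := by omega
    interval_cases m <;> interval_cases k <;> first | omega | decide

/-- Bounding a split hypergraph. -/
theorem split_card {H : Finset (Finset V)} (hH : ∀ e ∈ H, e.card = 3) {A U : Finset V}
    (hs : ∀ e ∈ H, e ⊆ U ∨ e ⊆ A \ U) :
    H = H.filter (fun e => e ⊆ U) ∪ H.filter (fun e => e ⊆ A \ U) := by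
  ext e
  simp only [Finset.mem_union, Finset.mem_filter]
  have := hs e
  tauto

theorem split_card_le {H : Finset (Finset V)} (hH : ∀ e ∈ H, e.card = 3) {A U : Finset V}
    (hs : ∀ e ∈ H, e ⊆ U ∨ e ⊆ A \ U) (hU : U.card = 6) :
    H.card ≤ (H.filter (fun e => e ⊆ U)).card + (H.filter (fun e => e ⊆ A \ U)).card ∧
    (H.filter (fun e => e ⊆ U)).card ≤ 20 := by
  constructor
  · conv_lhs => rw [split_card hH hs]
    exact Finset.card_union_le _ _
  · have := card_le_choose (H := H.filter (fun e => e ⊆ U)) (A := U)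
      (fun e he => hH e (Finset.mem_filter.1 he).1) (fun e he => (Finset.mem_filter.1 he).2)
    rw [hU] at this
    exact this

theorem P_free (m : ℕ) : ∀ (A : Finset V) (H : Finset (Finset V)), A.card = m →
    (∀ e ∈ H, e.card = 3) → (∀ e ∈ H, e ⊆ A) → ¬ HasP33 H →
    H.card ≤ F33 m ∧ (8 ≤ m → H.card = (m - 1).choose 2 →
      ∃ v ∈ A, H = (A.powersetCard 3).filter (fun e => v ∈ e)) := by
  induction m using Nat.strong_induction_on with
  | _ m ih =>
  intro A H hAm hH hA hP
  by_cases h6 : m ≤ 6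
  · refine ⟨?_, fun h => by omega⟩
    rw [F33, if_pos h6, ← hAm]
    exact card_le_choose hH hA
  have hF : 8 ≤ m → F33 m = (m - 1).choose 2 := fun h => by
    rw [F33, if_neg (by omega), if_neg (by omega)]
  by_cases hC : HasC33 H
  · obtain ⟨a, b, c, d, e, f, hT⟩ := hC.tri
    have sub : ∀ B : Finset V, B.card < m → (H.filter (fun e => e ⊆ B)).card ≤ F33 B.card :=
      fun B hB => (ih B.card hB B _ rfl (fun e he => hH e (Finset.mem_filter.1 he).1)
        (fun e he => (Finset.mem_filter.1 he).2)
        (fun h => noP_mono (Finset.filter_subset _ _) hP h)).1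
    have main : H.card ≤ 20 + F33 (m - 6) ∨
        ∃ k, 1 ≤ k ∧ k ≤ m - 6 ∧ H.card ≤ 14 + 3 * k + F33 (m - 6 - k) := by
      obtain ⟨U, hUA, hU, hs | ⟨k, hk, hk', B, hB, hle⟩⟩ := hT.struct hH hP hA
      · left
        have h1 := split_card_le hH hs hU
        have hc : (A \ U).card = m - 6 := by rw [Finset.card_sdiff_of_subset hUA, hU, hAm]
        have h2 := sub (A \ U) (by omega)
        rw [hc] at h2
        omega
      · right
        rw [hAm] at hk' hB
        have h2 := sub B (by omega)
        rw [hB] at h2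
        exact ⟨k, hk, hk', by omega⟩
    by_cases h7 : m = 7
    · subst h7
      refine ⟨?_, fun h => by omega⟩
      rcases main with h | ⟨k, hk, hk', h⟩
      · exact h
      · have : k = 1 := by omega
        subst this
        refine h.trans ?_
        decide
    · have h8 : 8 ≤ m := by omega
      have hlt : H.card < (m - 1).choose 2 := by
        rcases main with h | ⟨k, hk, hk', h⟩
        · exact h.trans_lt (num1 m h8)
        · exact h.trans_lt (num2 m k h8 hk hk')
      rw [hF h8]
      exact ⟨hlt.le, fun _ h => absurd h hlt.ne⟩
  · have := PC_free m (by omega) A H hAm hH hA hP hC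
    refine ⟨?_, this.2⟩
    by_cases h7 : m = 7
    · subst h7
      refine this.1.trans ?_
      decide
    · rw [hF (by omega)]
      exact this.1

/-- The extremal hypergraph. -/
def ext33 (A S : Finset V) (v : V) : Finset (Finset V) :=
  S.powersetCard 3 ∪ ((A \ S).powersetCard 3).filter (fun e => v ∈ e)

theorem ext33_uniform {A S : Finset V} {v : V} : ∀ e ∈ ext33 A S v, e.card = 3 := by
  intro e he
  simp only [ext33, Finset.mem_union, Finset.mem_powersetCard, Finset.mem_filter] at he
  tauto

theorem ext33_noP {A S : Finset V} {v : V} (hS : S.card = 6) : ¬ HasP33 (ext33 A S v) := by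
  rintro ⟨e₁, e₂, e₃, h1, h2, h3, h12, h23, h13⟩
  have meet : ∀ x y : Finset V, x ⊆ S → y ⊆ A \ S → x ∩ y = ∅ := by
    intro x y hx hy
    ext z
    have := @hx z
    have := @hy z
    simp only [Finset.mem_inter, Finset.mem_sdiff] at *
    simp
    tauto
  simp only [ext33, Finset.mem_union, Finset.mem_powersetCard, Finset.mem_filter] at h1 h2 h3
  rcases h2 with h2 | h2
  · have a1 : e₁ ⊆ S ∧ e₁.card = 3 := by
      rcases h1 with h1 | h1
      · exact h1
      · rw [Finset.inter_comm, meet _ _ h2.1 h1.1.1] at h12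
        simp at h12
    have a3 : e₃ ⊆ S ∧ e₃.card = 3 := by
      rcases h3 with h3 | h3
      · exact h3
      · rw [meet _ _ h2.1 h3.1.1] at h23
        simp at h23
    have hu : e₁ ∪ e₃ = S := by
      apply Finset.eq_of_subset_of_card_le (Finset.union_subset a1.1 a3.1)
      rw [Finset.card_union_of_disjoint (Finset.disjoint_iff_inter_eq_empty.2 h13)]
      omega
    have : e₂ = (e₁ ∩ e₂) ∪ (e₂ ∩ e₃) := by
      rw [Finset.inter_comm e₁, ← Finset.inter_union_distrib_left, hu]
      exact (Finset.inter_eq_left.2 h2.1).symm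
    have hle := Finset.card_union_le (e₁ ∩ e₂) (e₂ ∩ e₃)
    rw [← this] at hle
    omega
  · have a1 : v ∈ e₁ := by
      rcases h1 with h1 | h1
      · rw [meet _ _ h1.1 h2.1.1] at h12
        simp at h12
      · exact h1.2
    have a3 : v ∈ e₃ := by
      rcases h3 with h3 | h3
      · rw [Finset.inter_comm, meet _ _ h3.1 h2.1.1] at h23
        simp at h23
      · exact h3.2
    have : v ∈ e₁ ∩ e₃ := Finset.mem_inter.2 ⟨a1, a3⟩
    rw [h13] at this
    simp at this

theorem ext33_card {A S : Finset V} {v : V} (hSA : S ⊆ A) (hS : S.card = 6) (hv : v ∈ A \ S) :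
    (ext33 A S v).card = 20 + (A.card - 7).choose 2 := by
  rw [ext33, Finset.card_union_of_disjoint, star_card hv, Finset.card_powersetCard, hS,
    Finset.card_sdiff_of_subset hSA, hS]
  · rfl
  · rw [Finset.disjoint_left]
    intro e he he'
    simp only [Finset.mem_powersetCard, Finset.mem_filter] at he he'
    have h1 := he'.1.1 he'.2
    have h2 := he.1 he'.2
    rw [Finset.mem_sdiff] at h1
    exact h1.2 h2

theorem ext33_C {A S : Finset V} {v : V} (hS : S.card = 6) : HasC33 (ext33 A S v) := by
  have e : Fin 6 ≃ S := (S.equivFinOfCardEq hS).symm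
  have hinj : ∀ i j, (e i : V) = e j ↔ i = j := fun i j => by
    rw [Subtype.coe_inj, e.apply_eq_iff_eq]
  have mem : ∀ i j k : Fin 6, i ≠ j → i ≠ k → j ≠ k →
      ({(e i : V), (e j : V), (e k : V)} : Finset V) ∈ ext33 A S v := by
    intro i j k h1 h2 h3
    rw [ext33, Finset.mem_union, Finset.mem_powersetCard]
    left
    refine ⟨?_, ?_⟩
    · intro x hx
      simp only [Finset.mem_insert, Finset.mem_singleton] at hx
      rcases hx with rfl | rfl | rfl <;> exact Subtype.coe_prop _
    · rw [Finset.card_eq_three]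
      exact ⟨_, _, _, by rwa [Ne, hinj], by rwa [Ne, hinj], by rwa [Ne, hinj], rfl⟩
  refine ⟨e 0, e 1, e 2, e 3, e 4, e 5, ?_, mem _ _ _ ?_ ?_ ?_, mem _ _ _ ?_ ?_ ?_,
    mem _ _ _ ?_ ?_ ?_⟩
  · have h1 : ({(e 0 : V), (e 1 : V), (e 2 : V), (e 3 : V), (e 4 : V), (e 5 : V)} : Finset V) =
        (Finset.univ : Finset (Fin 6)).image (fun i => (e i : V)) := by
      ext x
      simp [Fin.exists_fin_succ, eq_comm]
    rw [h1, Finset.card_image_of_injective _ (fun i j h => (hinj i j).1 h)]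
    rfl
  all_goals decide

theorem upper33 {A : Finset V} {H : Finset (Finset V)} (hn : 14 ≤ A.card)
    (hH : ∀ e ∈ H, e.card = 3) (hA : ∀ e ∈ H, e ⊆ A) (hP : ¬ HasP33 H) (hC : HasC33 H) :
    H.card ≤ 20 + (A.card - 7).choose 2 ∧ (H.card = 20 + (A.card - 7).choose 2 →
      ∃ S ⊆ A, S.card = 6 ∧ ∃ v ∈ A \ S, H = ext33 A S v) := by
  obtain ⟨a, b, c, d, e, f, hT⟩ := hC.tri
  have sub := fun B : Finset V => P_free B.card B (H.filter (fun e => e ⊆ B)) rfl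
    (fun e he => hH e (Finset.mem_filter.1 he).1)
    (fun e he => (Finset.mem_filter.1 he).2)
    (fun h => noP_mono (Finset.filter_subset _ _) hP h)
  obtain ⟨U, hUA, hU, hs | ⟨k, hk, hk', B, hB, hle⟩⟩ := hT.struct hH hP hA
  · have h1 := split_card_le hH hs hU
    have hc : (A \ U).card = A.card - 6 := by rw [Finset.card_sdiff_of_subset hUA, hU]
    have h2 := sub (A \ U)
    have hF : F33 (A \ U).card = (A.card - 7).choose 2 := by
      rw [hc, F33, if_neg (by omega), if_neg (by omega)]; congr 1
    rw [hF] at h2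
    refine ⟨by omega, fun heq => ⟨U, hUA, hU, ?_⟩⟩
    have h7 : (A \ U).card - 1 = A.card - 7 := by omega
    obtain ⟨v, hv, hst⟩ := h2.2 (by omega) (by rw [h7]; omega)
    refine ⟨v, hv, ?_⟩
    have hin : H.filter (fun e => e ⊆ U) = U.powersetCard 3 := by
      apply Finset.eq_of_subset_of_card_le
      · intro e he
        rw [Finset.mem_filter] at he
        exact Finset.mem_powersetCard.2 ⟨he.2, hH e he.1⟩
      · rw [Finset.card_powersetCard, hU]
        have : Nat.choose 6 3 = 20 := rfl
        omega
    rw [ext33, ← hin, ← hst]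
    exact split_card hH hs
  · have h2 := (sub B).1
    rw [hB] at h2
    have := num3 A.card k hn hk hk'
    exact ⟨by omega, fun h => by omega⟩

end helpers

theorem conditional_turan_P33_C33_large (n : ℕ) (hn : 14 ≤ n) :
    IsGreatest {m : ℕ | ∃ H : Finset (Finset (Fin n)),
      (∀ e ∈ H, e.card = 3) ∧ ¬ HasP33 H ∧ HasC33 H ∧ H.card = m}
      (20 + (n - 7).choose 2) ∧
    ∀ H : Finset (Finset (Fin n)), (∀ e ∈ H, e.card = 3) → ¬ HasP33 H → HasC33 H →
      H.card = 20 + (n - 7).choose 2 →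
      ∃ S : Finset (Fin n), S.card = 6 ∧ ∃ v ∉ S,
        H = S.powersetCard 3 ∪
          ((Finset.univ \ S).powersetCard 3).filter (fun e => v ∈ e) := by
  have hcard : (Finset.univ : Finset (Fin n)).card = n := by simp
  have up := fun (H : Finset (Finset (Fin n))) (hH : ∀ e ∈ H, e.card = 3) (hP : ¬ HasP33 H)
    (hC : HasC33 H) => upper33 (A := Finset.univ) (by rw [hcard]; exact hn) hH
      (fun e _ => Finset.subset_univ e) hP hC
  rw [hcard] at up
  refine ⟨⟨?_, ?_⟩, ?_⟩
  · obtain ⟨S, hSA, hS⟩ := Finset.exists_subset_card_eq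
      (s := (Finset.univ : Finset (Fin n))) (n := 6) (by rw [hcard]; omega)
    have hne : (Finset.univ \ S).Nonempty := by
      rw [← Finset.card_pos, Finset.card_sdiff_of_subset hSA, hS, hcard]
      omega
    obtain ⟨v, hv⟩ := hne
    refine ⟨ext33 Finset.univ S v, ext33_uniform, ext33_noP hS, ext33_C hS, ?_⟩
    rw [ext33_card hSA hS hv, hcard]
  · rintro m ⟨H, hH, hP, hC, rfl⟩
    exact (up H hH hP hC).1
  · intro H hH hP hC heq
    obtain ⟨S, -, hS, v, hv, h⟩ := (up H hH hP hC).2 heq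
    exact ⟨S, hS, v, (Finset.mem_sdiff.1 hv).2, h⟩
end
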